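/- arXiv:1511.03478 — 4 statements merged into one kernel-verified Lean document; each statement's English description precedes it below -/
import Mathlib

section
/- Suppose a flow γ on a compact metric space Y has a totally disconnected cross section. Suppose Y' ⊆ Y is a nonempty compact subset invariant under the flow, and χ ∈ Homeo₊ⁱˢᵒ(Y') with respect to the restriction of γ to Y'. Then χ extends to a homeomorphism χ̃ : Y → Y with χ̃|_{Y'} = χ and χ̃ ∈ Homeo₊ⁱˢᵒ(Y). -/
open Set Topology

section FlowDefs

variable {Y Y' : Type*} [TopologicalSpace Y] [TopologicalSpace Y']

/-- A fixed point free continuous flow on a topological space. -/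
def IsFlow (γ : Y → ℝ → Y) : Prop :=
  Continuous (fun p : Y × ℝ => γ p.1 p.2) ∧
  (∀ y s t, γ (γ y s) t = γ y (s + t)) ∧
  (∀ y, γ y 0 = y) ∧
  (∀ y, ∃ t, γ y t ≠ y)

/-- The orbit of a point under a flow. -/
def flowOrbit (γ : Y → ℝ → Y) (y : Y) : Set Y := Set.range (γ y)

/-- A cross section of a flow: a closed subset `C` such that
`(x,t) ↦ γ x t` is surjective `C × ℝ → Y` and a local homeomorphism. -/
def IsCrossSection (γ : Y → ℝ → Y) (C : Set Y) : Prop :=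
  IsClosed C ∧
  Function.Surjective (fun p : C × ℝ => γ p.1.1 p.2) ∧
  IsLocalHomeomorph (fun p : C × ℝ => γ p.1.1 p.2)

/-- A flow map: a continuous map sending each orbit onto an orbit by an
orientation preserving local homeomorphism. -/
def IsFlowMap (γ : Y → ℝ → Y) (γ' : Y' → ℝ → Y') (h : Y → Y') : Prop :=
  Continuous h ∧
  (∀ y, h '' flowOrbit γ y = flowOrbit γ' (h y)) ∧
  (∀ y, ∃ ε > (0:ℝ), ∃ c : ℝ → ℝ,
    ContinuousOn c (Ioo (-ε) ε) ∧ StrictMonoOn c (Ioo (-ε) ε) ∧ c 0 = 0 ∧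
    ∀ t : ℝ, |t| < ε → h (γ y t) = γ' (h y) (c t))

/-- Membership in `Homeo₊(Y)`: a self flow equivalence. -/
def MemHomeoPlus (γ : Y → ℝ → Y) (h : Y → Y) : Prop :=
  IsFlowMap γ γ h ∧ IsHomeomorph h

/-- Membership in `Homeo₊ᵒʳᵇ(Y)`: a self flow equivalence mapping each orbit onto itself. -/
def MemHomeoPlusOrb (γ : Y → ℝ → Y) (h : Y → Y) : Prop :=
  MemHomeoPlus γ h ∧ ∀ y, h '' flowOrbit γ y = flowOrbit γ y

/-- Membership in `Homeo₊ⁱˢᵒ(Y)`: an element of `Homeo₊ᵒʳᵇ(Y)` isotopic to the identity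
within `Homeo₊(Y)`. -/
def MemHomeoPlusIso (γ : Y → ℝ → Y) (h : Y → Y) : Prop :=
  MemHomeoPlusOrb γ h ∧
  ∃ H : Y → ℝ → Y,
    ContinuousOn (fun p : Y × ℝ => H p.1 p.2) (Set.univ ×ˢ Set.Icc 0 1) ∧
    (∀ t ∈ Set.Icc (0:ℝ) 1, MemHomeoPlus γ (fun y => H y t)) ∧
    (∀ y, H y 0 = y) ∧ (∀ y, H y 1 = h y)

/-- A discrete cross section for a (homeomorphic) self-map `T` of a space:
a closed set meeting every orbit, with well-defined continuous return time. -/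
def IsDiscreteCrossSection {Z : Type*} [TopologicalSpace Z] (T : Z → Z) (K : Set Z) : Prop :=
  IsClosed K ∧
  (∀ z : Z, ∃ x ∈ K, ∃ k : ℕ, T^[k] x = z) ∧
  ∃ r : K → ℕ, Continuous r ∧ ∀ x : K, IsLeast {k : ℕ | 1 ≤ k ∧ T^[k] (x : Z) ∈ K} (r x)

end FlowDefs

section SubshiftDefs

/-- The left shift on bisequences. -/
def shiftMap {A : Type*} : (ℤ → A) → (ℤ → A) := fun x n => x (n + 1)

/-- The word `w` occurs in `x` at position `n`. -/
def wordOccursAt {A : Type*} (w : List A) (x : ℤ → A) (n : ℤ) : Prop :=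
  ∀ (i : ℕ) (hi : i < w.length), x (n + i) = w.get ⟨i, hi⟩

/-- The word `w` occurs in some point of `X`. -/
def wordOccursIn {A : Type*} (w : List A) (X : Set (ℤ → A)) : Prop :=
  ∃ x ∈ X, ∃ n : ℤ, wordOccursAt w x n

/-- A subshift: nonempty, closed, shift-invariant subset of `A^ℤ`. -/
def IsSubshift {A : Type*} [TopologicalSpace A] (X : Set (ℤ → A)) : Prop :=
  X.Nonempty ∧ IsClosed X ∧ shiftMap '' X = X

/-- A shift of finite type: the set of bisequences avoiding a finite set of forbidden words. -/
def IsSFT {A : Type*} (X : Set (ℤ → A)) : Prop :=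
  ∃ F : Set (List A), F.Finite ∧ X = {x | ∀ w ∈ F, ∀ n : ℤ, ¬ wordOccursAt w x n}

/-- An irreducible subshift. -/
def IsIrreducibleSubshift {A : Type*} (X : Set (ℤ → A)) : Prop :=
  ∀ u v : List A, wordOccursIn u X → wordOccursIn v X →
    ∃ w : List A, wordOccursIn (u ++ w ++ v) X

end SubshiftDefs

section ReparametrizationOfFlows

/-- A locally strictly increasing continuous real function is strictly increasing. -/
theorem strictMono_of_eventually_lt {f : ℝ → ℝ} (hf : Continuous f)
    (h : ∀ t, ∀ᶠ s in 𝓝[>] t, f t < f s) : StrictMono f := by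
  have mono : ∀ a b, a ≤ b → f a ≤ f b := by
    intro a b hab
    have hcl : IsClosed ({x | f a ≤ f x} ∩ Icc a b) :=
      (isClosed_le continuous_const hf).inter isClosed_Icc
    exact hcl.Icc_subset_of_forall_mem_nhdsWithin (le_refl (f a))
      (fun x hx => (h x).mono fun s hs => hx.1.out.trans hs.le) (right_mem_Icc.2 hab)
  intro a b hab
  obtain ⟨s, h1, h2⟩ := ((h a).and (Ioo_mem_nhdsGT hab)).exists
  exact h1.trans_le (mono _ _ h2.2.le)

variable {Y : Type*} [TopologicalSpace Y] {γ : Y → ℝ → Y}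

theorem IsFlow.continuous_comp (hγ : IsFlow γ) {X : Type*} [TopologicalSpace X] {p : X → Y}
    {τ : X → ℝ} (hp : Continuous p) (hτ : Continuous τ) : Continuous fun x => γ (p x) (τ x) :=
  hγ.1.comp (hp.prodMk hτ)

/-- Moving each point `y` along its orbit by a continuous time `b y`, in such a way that the order
along orbits is strictly preserved, is a self flow equivalence. -/
theorem IsFlow.memHomeoPlusOrb [CompactSpace Y] [T2Space Y] (hγ : IsFlow γ) {b : Y → ℝ}
    (hb : Continuous b) (hmono : ∀ y, StrictMono fun t => t + b (γ y t)) :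
    MemHomeoPlusOrb γ fun y => γ y (b y) := by
  have hcont : Continuous fun y => γ y (b y) := hγ.continuous_comp continuous_id hb
  have key : ∀ y t, γ (γ y t) (b (γ y t)) = γ y (t + b (γ y t)) := fun y t => hγ.2.1 y t _
  have fcont : ∀ y, Continuous fun t => t + b (γ y t) := fun y =>
    continuous_id.add (hb.comp (hγ.continuous_comp continuous_const continuous_id))
  have surj : ∀ y, Function.Surjective fun t => t + b (γ y t) := by
    intro y
    obtain ⟨M, hM⟩ := (isCompact_range hb).isBounded.exists_norm_le
    have hM' : ∀ z, |b z| ≤ M := fun z => hM _ (mem_range_self z)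
    apply (fcont y).surjective
    · exact Filter.tendsto_atTop_add_right_of_le _ (-M) Filter.tendsto_id
        fun t => (abs_le.1 (hM' _)).1
    · exact Filter.tendsto_atBot_add_right_of_ge _ M Filter.tendsto_id
        fun t => (abs_le.1 (hM' _)).2
  have orb : ∀ y, (fun y => γ y (b y)) '' flowOrbit γ y = flowOrbit γ y := by
    intro y
    apply Subset.antisymm
    · rintro _ ⟨_, ⟨t, rfl⟩, rfl⟩
      exact ⟨_, (key y t).symm⟩
    · rintro _ ⟨t, rfl⟩
      obtain ⟨s, hs⟩ := surj y t
      exact ⟨γ y s, ⟨s, rfl⟩, (key y s).trans (congrArg (γ y) hs)⟩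
  have orb' : ∀ y t, flowOrbit γ (γ y t) = flowOrbit γ y := by
    intro y t
    apply Subset.antisymm
    · rintro _ ⟨s, rfl⟩
      exact ⟨t + s, (hγ.2.1 y t s).symm⟩
    · rintro _ ⟨s, rfl⟩
      exact ⟨s - t, by simp [hγ.2.1]⟩
  refine ⟨⟨⟨hcont, fun y => (orb y).trans (orb' y _).symm, fun y => ?_⟩, ?_⟩, orb⟩
  · refine ⟨1, one_pos, fun t => t + b (γ y t) - b y, ?_, ?_, ?_, ?_⟩
    · exact ((fcont y).sub continuous_const).continuousOn
    · intro s _ t _ hst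
      have := hmono y hst
      simp only at this ⊢
      linarith
    · simp [hγ.2.2.1]
    · intro t _
      simp only [hγ.2.1]
      congr 1
      ring
  · rw [isHomeomorph_iff_continuous_bijective]
    refine ⟨hcont, ?_, ?_⟩
    · intro y z hyz
      have hz : z = γ y (b y - b z) := by
        have := congrArg (fun w => γ w (-b z)) hyz
        simp only [hγ.2.1, add_neg_cancel, hγ.2.2.1] at this
        rw [sub_eq_add_neg, this]
      have h0 : b y - b z = 0 := by
        apply (hmono y).injective
        simp only [← hz, hγ.2.2.1]
        ring
      rw [hz, h0, hγ.2.2.1]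
    · intro z
      have : z ∈ (fun y => γ y (b y)) '' flowOrbit γ z := by
        rw [orb]
        exact ⟨0, hγ.2.2.1 z⟩
      obtain ⟨w, -, hw⟩ := this
      exact ⟨w, hw⟩

theorem IsFlow.memHomeoPlusIso [CompactSpace Y] [T2Space Y] (hγ : IsFlow γ) {b : Y → ℝ}
    (hb : Continuous b) (hmono : ∀ y, StrictMono fun t => t + b (γ y t)) :
    MemHomeoPlusIso γ fun y => γ y (b y) := by
  refine ⟨hγ.memHomeoPlusOrb hb hmono, fun y s => γ y (s * b y), ?_, ?_, ?_, ?_⟩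
  · exact (hγ.continuous_comp continuous_fst
      (continuous_snd.mul (hb.comp continuous_fst))).continuousOn
  · intro s hs
    refine (hγ.memHomeoPlusOrb (b := fun y => s * b y) (continuous_const.mul hb) ?_).1
    intro y t u htu
    have := hmono y htu
    simp only at this ⊢
    rcases hs.1.eq_or_lt with rfl | h
    · simpa using htu
    · nlinarith [hs.2]
  · intro y
    simp [hγ.2.2.1]
  · intro y
    simp

/-- A flow with a cross section has no arbitrarily short periods. -/
theorem IsCrossSection.exists_period_bound [CompactSpace Y] {C : Set Y} (hC : IsCrossSection γ C)
    (hγ : IsFlow γ) : ∃ ε > 0, ∀ y t, |t| < ε → γ y t = y → t = 0 := by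
  suffices h : ∃ ε > 0, ∀ y ∈ (univ : Set Y), ∀ t, |t| < ε → γ y t = y → t = 0 by simpa using h
  refine isCompact_univ.induction_on
    (p := fun A : Set Y => ∃ ε > 0, ∀ y ∈ A, ∀ t, |t| < ε → γ y t = y → t = 0) ?_ ?_ ?_ ?_
  · exact ⟨1, one_pos, by simp⟩
  · rintro s t hst ⟨ε, hε, h⟩
    exact ⟨ε, hε, fun y hy => h y (hst hy)⟩
  · rintro s t ⟨ε, hε, h⟩ ⟨ε', hε', h'⟩
    refine ⟨min ε ε', lt_min hε hε', ?_⟩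
    rintro y (hy | hy) u hu
    · exact h y hy u (hu.trans_le (min_le_left _ _))
    · exact h' y hy u (hu.trans_le (min_le_right _ _))
  · intro y _
    obtain ⟨p, hp⟩ := hC.2.1 y
    obtain ⟨e, hpe, he⟩ := hC.2.2 p
    have hye : e p = y := by rw [← he]; exact hp
    have hyt : y ∈ e.target := hye ▸ e.map_source hpe
    have hsy : e.symm y = p := by rw [← hye, e.left_inv hpe]
    have hca : ContinuousAt (fun q : Y × ℝ => ((e.symm q.1).1, (e.symm q.1).2 + q.2)) (y, 0) := by
      have h1 : ContinuousAt (fun q : Y × ℝ => e.symm q.1) (y, 0) :=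
        ContinuousAt.comp (f := Prod.fst) (x := (y, (0 : ℝ))) (e.continuousAt_symm hyt)
          continuousAt_fst
      exact h1.fst.prodMk (h1.snd.add continuousAt_snd)
    have hev : ∀ᶠ q : Y × ℝ in 𝓝 (y, 0),
        ((e.symm q.1).1, (e.symm q.1).2 + q.2) ∈ e.source ∧ q.1 ∈ e.target := by
      refine (hca.eventually_mem (e.open_source.mem_nhds ?_)).and
        (continuousAt_fst.eventually_mem (e.open_target.mem_nhds hyt))
      simpa [hsy] using hpe
    rw [nhds_prod_eq] at hev
    obtain ⟨V, hV, W, hW, hVW⟩ := Filter.eventually_prod_iff.1 hev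
    obtain ⟨ε, hε, hεW⟩ := Metric.eventually_nhds_iff.1 hW
    refine ⟨{z | V z}, mem_nhdsWithin_of_mem_nhds hV, ε, hε, ?_⟩
    intro z hz t ht hzt
    obtain ⟨h1, h2⟩ := hVW hz (hεW (by simpa using ht))
    have hez : γ (e.symm z).1 (e.symm z).2 = z := by
      have := e.right_inv h2
      rwa [← he] at this
    have := e.injOn h1 (e.map_target h2) (by
      rw [← he]
      simp only
      rw [← hγ.2.1, hez, hzt])
    have := congrArg Prod.snd this
    simpa using this

/-- If `q x` is obtained from `p x` by flowing for a short time, and there are no short periods,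
then the flow time depends continuously on `x`. -/
theorem IsFlow.exists_continuous_time [T2Space Y] (hγ : IsFlow γ) {ε : ℝ}
    (hε : ∀ y t, |t| < ε → γ y t = y → t = 0) {X : Type*} [TopologicalSpace X] {p q : X → Y}
    (hp : Continuous p) (hq : Continuous q) (h : ∀ x, ∃ τ, |τ| < ε / 3 ∧ γ (p x) τ = q x) :
    ∃ τ : X → ℝ, Continuous τ ∧ ∀ x, γ (p x) (τ x) = q x := by
  choose τ hτ hpq using h
  refine ⟨τ, ?_, hpq⟩
  rw [continuous_iff_ultrafilter]
  intro x g hg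
  obtain ⟨a, ha, hga⟩ := (isCompact_Icc (a := -(ε / 3)) (b := ε / 3)).ultrafilter_le_nhds
    (g.map τ) (by
      rw [Filter.le_principal_iff]
      exact Filter.mem_map.2 (Filter.univ_mem' fun x => abs_le.1 (hτ x).le))
  have hga' : Filter.Tendsto τ g (𝓝 a) := hga
  have h1 : Filter.Tendsto (fun x => γ (p x) (τ x)) g (𝓝 (γ (p x) a)) :=
    (hγ.1.tendsto (p x, a)).comp (((hp.tendsto x).mono_left hg).prodMk_nhds hga')
  have h2 : Filter.Tendsto (fun x => γ (p x) (τ x)) g (𝓝 (q x)) := by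
    simpa only [hpq] using (hq.tendsto x).mono_left hg
  have h3 : γ (p x) a = γ (p x) (τ x) := (tendsto_nhds_unique h1 h2).trans (hpq x).symm
  have h4 : a - τ x = 0 := by
    apply hε (γ (p x) (τ x))
    · have := abs_lt.1 (hτ x)
      rw [abs_lt]
      constructor <;> linarith [ha.1, ha.2]
    · rw [hγ.2.1, add_sub_cancel, h3]
  rwa [← sub_eq_zero.1 h4]

/-- If the flow times `b` represent a map which locally preserves the direction of the flow, then
they preserve the order along orbits. -/
theorem IsFlow.strictMono_time (hγ : IsFlow γ) {ε : ℝ} (hε0 : 0 < ε)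
    (hε : ∀ y t, |t| < ε → γ y t = y → t = 0) {b : Y → ℝ} (hb : Continuous b)
    (hloc : ∀ y, ∃ ε > (0:ℝ), ∃ c : ℝ → ℝ,
      ContinuousOn c (Ioo (-ε) ε) ∧ StrictMonoOn c (Ioo (-ε) ε) ∧ c 0 = 0 ∧
      ∀ t : ℝ, |t| < ε → γ (γ y t) (b (γ y t)) = γ (γ y (b y)) (c t)) (y : Y) :
    StrictMono fun t => t + b (γ y t) := by
  have hbc : ∀ z, Continuous fun t => b (γ z t) := fun z =>
    hb.comp (hγ.continuous_comp continuous_const continuous_id)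
  refine strictMono_of_eventually_lt (continuous_id.add (hbc y)) fun t => ?_
  obtain ⟨η, hη, c, hc, hcm, hc0, hct⟩ := hloc (γ y t)
  have h0 : Ioo (-η) η ∈ 𝓝 (0 : ℝ) := Ioo_mem_nhds (by linarith) hη
  have hca : ContinuousAt (fun τ => τ + b (γ (γ y t) τ) - b (γ y t) - c τ) 0 :=
    ((continuousAt_id.add (hbc _).continuousAt).sub continuousAt_const).sub (hc.continuousAt h0)
  have hsmall : ∀ᶠ τ in 𝓝 (0 : ℝ), |τ + b (γ (γ y t) τ) - b (γ y t) - c τ| < ε := by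
    refine hca.abs.eventually_lt continuousAt_const ?_
    simpa [hγ.2.2.1, hc0] using hε0
  have hev : ∀ᶠ τ in 𝓝 (0 : ℝ), 0 < τ → t + b (γ y t) < (t + τ) + b (γ y (t + τ)) := by
    filter_upwards [hsmall, h0] with τ h1 h2 hτ
    have h3 := hct τ (abs_lt.2 h2)
    have h4 : τ + b (γ (γ y t) τ) - b (γ y t) - c τ = 0 := by
      refine hε (γ (γ (γ y t) (b (γ y t))) (c τ)) _ h1 ?_
      rw [hγ.2.1 _ (c τ), hγ.2.1 _ (b (γ y t)), ← h3, hγ.2.1 _ τ]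
      congr 1
      ring
    have h5 := hcm (mem_Ioo.2 ⟨by linarith, hη⟩) h2 hτ
    rw [hc0] at h5
    rw [hγ.2.1 y t τ] at h4
    linarith
  have hsub : Filter.Tendsto (fun s => s - t) (𝓝[>] t) (𝓝 0) := by
    have : ContinuousAt (fun s : ℝ => s - t) t := by fun_prop
    simpa [ContinuousAt] using this.tendsto.mono_left nhdsWithin_le_nhds
  filter_upwards [hsub.eventually hev, self_mem_nhdsWithin] with s hs hts
  simpa using hs (sub_pos.2 hts)

/-- Suprema depend continuously on a parameter for uniformly equicontinuous families. -/
theorem continuous_iSup_of_forall_le {ι : Type*} [Nonempty ι] {F : Y → ι → ℝ}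
    (hbdd : ∀ y, BddAbove (range (F y)))
    (h : ∀ y, ∀ ε > 0, ∀ᶠ z in 𝓝 y, ∀ i, |F z i - F y i| ≤ ε) :
    Continuous fun y => ⨆ i, F y i := by
  rw [Metric.continuous_iff']
  intro y ε hε
  filter_upwards [h y (ε / 2) (half_pos hε)] with z hz
  rw [Real.dist_eq]
  refine lt_of_le_of_lt (abs_sub_le_iff.2 ⟨?_, ?_⟩) (half_lt_self hε)
  · rw [sub_le_iff_le_add]
    refine ciSup_le fun i => ?_
    linarith [(abs_le.1 (hz i)).2, le_ciSup (hbdd y) i]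
  · rw [sub_le_iff_le_add]
    refine ciSup_le fun i => ?_
    linarith [(abs_le.1 (hz i)).1, le_ciSup (hbdd z) i]

/-- A continuous function vanishing exactly on a given closed invariant set, and varying slowly
along orbits relative to its size. -/
theorem IsFlow.exists_slowly_varying {Y : Type*} [MetricSpace Y] {γ : Y → ℝ → Y}
    (hγ : IsFlow γ) {A : Set Y} (hA : IsClosed A) (hne : A.Nonempty)
    (hinv : ∀ y ∈ A, ∀ t, γ y t ∈ A) {k : ℝ} (hk : 0 < k) :
    ∃ ψ : Y → ℝ, Continuous ψ ∧ (∀ y, 0 ≤ ψ y) ∧ (∀ y, ψ y ≤ 1) ∧ (∀ y, ψ y = 0 ↔ y ∈ A) ∧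
      ∀ y t, ψ (γ y t) ≤ (1 + k * |t|) * ψ y := by
  set d : Y → ℝ := fun y => min 1 (Metric.infDist y A) with hd
  have hdc : Continuous d := continuous_const.min (Metric.continuous_infDist_pt A)
  have hd0 : ∀ y, 0 ≤ d y := fun y => le_min zero_le_one Metric.infDist_nonneg
  have hd1 : ∀ y, d y ≤ 1 := fun y => min_le_left _ _
  have hdA : ∀ y, d y = 0 ↔ y ∈ A := by
    intro y
    rw [hA.mem_iff_infDist_zero hne]
    simp only [hd]
    rcases le_total 1 (Metric.infDist y A) with h | h
    · rw [min_eq_left h]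
      constructor <;> intro h' <;> linarith
    · rw [min_eq_right h]
  have hw : ∀ s : ℝ, 1 ≤ 1 + k * |s| := fun s => by
    linarith [mul_nonneg hk.le (abs_nonneg s)]
  obtain ⟨F, hF⟩ : ∃ F : Y → ℝ → ℝ, ∀ y s, F y s = d (γ y s) / (1 + k * |s|) :=
    ⟨fun y s => d (γ y s) / (1 + k * |s|), fun _ _ => rfl⟩
  have hF0 : ∀ y s, 0 ≤ F y s := fun y s => by
    rw [hF]
    exact div_nonneg (hd0 _) (by linarith [hw s])
  have hF1 : ∀ y s, F y s ≤ 1 := fun y s => by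
    rw [hF, div_le_one (by linarith [hw s])]
    exact (hd1 _).trans (hw s)
  have hbdd : ∀ y, BddAbove (range (F y)) := fun y => ⟨1, by rintro _ ⟨s, rfl⟩; exact hF1 y s⟩
  refine ⟨fun y => ⨆ s, F y s, ?_, ?_, ?_, ?_, ?_⟩
  · refine continuous_iSup_of_forall_le hbdd fun y ε hε => ?_
    have hFc : Continuous fun p : ℝ × Y => |F p.2 p.1 - F y p.1| := by
      have h1 : Continuous fun p : ℝ × Y => F p.2 p.1 :=
        ((hdc.comp (hγ.continuous_comp continuous_snd continuous_fst)).div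
          (by fun_prop) fun p => by linarith [hw p.1]).congr fun p => (hF _ _).symm
      have h2 : Continuous fun p : ℝ × Y => F y p.1 :=
        h1.comp (continuous_fst.prodMk continuous_const)
      exact (h1.sub h2).abs
    have hcpt : ∀ᶠ z in 𝓝 y, ∀ s ∈ Icc (-(1 / (k * ε))) (1 / (k * ε)), |F z s - F y s| < ε := by
      refine isCompact_Icc.eventually_forall_of_forall_eventually fun s _ => ?_
      exact (hFc.comp continuous_swap).continuousAt.eventually_lt continuousAt_const
        (by simpa using hε)
    filter_upwards [hcpt] with z hz s
    by_cases hs : s ∈ Icc (-(1 / (k * ε))) (1 / (k * ε))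
    · exact (hz s hs).le
    · have hs' : 1 / (k * ε) < |s| := by
        by_contra! h
        exact hs (abs_le.1 h)
      rw [div_lt_iff₀ (by positivity)] at hs'
      have hsm : ∀ w, F w s ≤ ε := by
        intro w
        rw [hF, div_le_iff₀ (by linarith [hw s])]
        nlinarith [hd1 (γ w s)]
      rw [abs_le]
      constructor <;> linarith [hsm y, hsm z, hF0 y s, hF0 z s]
  · exact fun y => Real.iSup_nonneg (hF0 y)
  · exact fun y => ciSup_le (hF1 y)
  · intro y
    constructor
    · intro h
      have h1 := le_ciSup (hbdd y) 0
      simp only [h] at h1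
      have h2 : F y 0 = d y := by simp [hF, hγ.2.2.1]
      exact (hdA y).1 (le_antisymm (h2 ▸ h1) (hd0 y))
    · intro h
      have : ∀ s, F y s = 0 := fun s => by simp [hF, (hdA _).2 (hinv y h s)]
      simp [this]
  · intro y t
    refine ciSup_le fun s => ?_
    have h1 : F y (t + s) ≤ ⨆ s, F y s := le_ciSup (hbdd y) _
    refine le_trans ?_ (mul_le_mul_of_nonneg_left h1 (by linarith [hw t]))
    simp only [hF, hγ.2.1]
    rw [← mul_div_assoc, div_le_div_iff₀ (by linarith [hw s]) (by linarith [hw (t + s)])]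
    have h2 : 1 + k * |t + s| ≤ (1 + k * |t|) * (1 + k * |s|) := by
      have := mul_le_mul_of_nonneg_left (abs_add_le t s) hk.le
      have := mul_nonneg (mul_nonneg hk.le (abs_nonneg t)) (mul_nonneg hk.le (abs_nonneg s))
      linarith
    calc _ ≤ d (γ y (t + s)) * ((1 + k * |t|) * (1 + k * |s|)) :=
          mul_le_mul_of_nonneg_left h2 (hd0 _)
      _ = _ := by ring

/-- Flow times preserving the order along orbits extend from closed invariant sets. -/
theorem IsFlow.exists_extension {Y : Type*} [MetricSpace Y] [CompactSpace Y] {γ : Y → ℝ → Y}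
    (hγ : IsFlow γ) {A : Set Y} (hA : IsClosed A) (hne : A.Nonempty)
    (hinv : ∀ y ∈ A, ∀ t, γ y t ∈ A) {β : A → ℝ} (hβ : Continuous β)
    (hmono : ∀ y : A, StrictMono fun t => t + β ⟨γ y t, hinv y y.2 t⟩) :
    ∃ b : Y → ℝ, Continuous b ∧ (∀ y : A, b y = β y) ∧ ∀ y, StrictMono fun t => t + b (γ y t) := by
  obtain ⟨f, hf⟩ := ContinuousMap.exists_restrict_eq hA ⟨β, hβ⟩
  have hfβ : ∀ y : A, f y = β y := fun y => congrArg (fun g : C(A, ℝ) => g y) hf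
  obtain ⟨M, hM0, hM⟩ : ∃ M > 0, ∀ y, |f y| ≤ M := by
    obtain ⟨M, hM⟩ := (isCompact_range f.continuous).isBounded.exists_pos_norm_le
    exact ⟨M, hM.1, fun y => hM.2 _ (mem_range_self y)⟩
  have hMl := fun y => (abs_le.1 (hM y)).1
  have hMu := fun y => (abs_le.1 (hM y)).2
  -- the least function above `f` which preserves the weak order along orbits
  set G : Y → ℝ → ℝ := fun y s => f (γ y (-s)) - s with hG
  set K : Set ℝ := Icc 0 (2 * M) with hK
  set g : Y → ℝ := fun y => sSup (G y '' K) with hg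
  have hGc : Continuous fun p : Y × ℝ => G p.1 p.2 :=
    (f.continuous.comp (hγ.continuous_comp continuous_fst continuous_snd.neg)).sub continuous_snd
  have hgc : Continuous g := isCompact_Icc.continuous_sSup hGc
  have h0K : (0 : ℝ) ∈ K := ⟨le_rfl, by linarith⟩
  have hbdd : ∀ y, BddAbove (G y '' K) := fun y =>
    ⟨M, by rintro _ ⟨s, hs, rfl⟩; linarith [hs.1, hMu (γ y (-s))]⟩
  have hGg : ∀ y, ∀ s ∈ K, G y s ≤ g y := fun y s hs => le_csSup (hbdd y) (mem_image_of_mem _ hs)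
  have hgle : ∀ y c, (∀ s ∈ K, G y s ≤ c) → g y ≤ c := fun y c h =>
    csSup_le ((nonempty_of_mem h0K).image _) (by rintro _ ⟨s, hs, rfl⟩; exact h s hs)
  have hfg : ∀ y, f y ≤ g y := fun y => by simpa [hG, hγ.2.2.1] using hGg y 0 h0K
  have hgM : ∀ y, |g y| ≤ M := fun y => abs_le.2
    ⟨(hMl y).trans (hfg y), hgle y M fun s hs => by
      simp only [hG]; linarith [hs.1, hMu (γ y (-s))]⟩
  have hgmono : ∀ y t, 0 ≤ t → g y - t ≤ g (γ y t) := by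
    intro y t ht
    rw [sub_le_iff_le_add]
    refine hgle y _ fun s hs => ?_
    rcases le_total (t + s) (2 * M) with h | h
    · have := hGg (γ y t) (t + s) ⟨by linarith [hs.1], h⟩
      simp only [hG, hγ.2.1, neg_add, add_neg_cancel_left] at this ⊢
      linarith
    · simp only [hG]
      linarith [hMu (γ y (-s)), hMl (γ y t), hfg (γ y t)]
  have hgβ : ∀ y : A, g y = β y := by
    intro y
    refine le_antisymm (hgle _ _ fun s hs => ?_) ((hfβ y).symm.trans_le (hfg y))
    have := (hmono y).monotone (neg_nonpos.2 hs.1)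
    simp only [hγ.2.2.1] at this
    simp only [hG]
    rw [hfβ ⟨_, hinv y y.2 (-s)⟩]
    linarith
  obtain ⟨ψ, hψc, hψ0, hψ1, hψA, hψ⟩ :=
    hγ.exists_slowly_varying hA hne hinv (k := 1 / (2 * M)) (by positivity)
  have hbA : ∀ y : A, (1 - ψ y) * g y = β y := fun y => by
    rw [(hψA y).2 y.2, hgβ]; ring
  refine ⟨fun y => (1 - ψ y) * g y, (continuous_const.sub hψc).mul hgc, hbA, ?_⟩
  intro y
  by_cases hy : y ∈ A
  · have := hmono ⟨y, hy⟩
    simpa only [hbA ⟨_, hinv y hy _⟩] using this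
  intro s t hst
  obtain ⟨τ, rfl⟩ : ∃ τ, t = s + τ := ⟨t - s, by ring⟩
  have hτ : 0 < τ := by linarith
  simp only
  rw [← hγ.2.1]
  have hyz : γ y s ∉ A := fun h => hy (by
    have := hinv _ h (-s)
    rwa [hγ.2.1, add_neg_cancel, hγ.2.2.1] at this)
  generalize γ y s = z at hyz
  have hv : 0 < ψ (γ z τ) := by
    refine lt_of_le_of_ne (hψ0 _) fun h => hyz ?_
    have := hinv _ ((hψA _).1 h.symm) (-τ)
    rwa [hγ.2.1, add_neg_cancel, hγ.2.2.1] at this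
  have h1 := hψ z τ
  have h2 := hψ (γ z τ) (-τ)
  rw [hγ.2.1, add_neg_cancel, hγ.2.2.1, abs_neg] at h2
  rw [abs_of_pos hτ] at h1 h2
  have h3 := hgmono z τ hτ.le
  have h4 := hψ1 (γ z τ)
  have hu := hψ0 z
  have hgz := hgM z
  generalize ψ (γ z τ) = v at *
  generalize ψ z = u at *
  have hkτ : 0 < 1 / (2 * M) * τ := by positivity
  have h5 : |u - v| ≤ 1 / (2 * M) * τ * v := by
    rw [abs_le]
    constructor
    · rcases le_total v u with h | h
      · nlinarith
      · nlinarith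
    · linarith
  have h6 : |(u - v) * g z| ≤ τ * v / 2 := by
    rw [abs_mul]
    calc _ ≤ 1 / (2 * M) * τ * v * M := mul_le_mul h5 hgz (abs_nonneg _) (by positivity)
      _ = _ := by field_simp
  have h7 := (abs_le.1 h6).1
  have h8 := mul_le_mul_of_nonneg_left h3 (sub_nonneg.2 h4)
  nlinarith [mul_pos hτ hv]

/-- For a totally disconnected cross section, small preconnected sets lie on short orbit
segments. -/
theorem IsCrossSection.exists_short_time {Y : Type*} [MetricSpace Y] [CompactSpace Y]
    {γ : Y → ℝ → Y} {C : Set Y} (hC : IsCrossSection γ C) (hγ : IsFlow γ)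
    (hCtd : IsTotallyDisconnected C) {ε : ℝ} (hε : 0 < ε) :
    ∃ δ > 0, ∀ A : Set Y, IsPreconnected A → ∀ z, A ⊆ Metric.ball z δ →
      ∀ a ∈ A, ∀ b ∈ A, ∃ τ, |τ| < ε ∧ γ a τ = b := by
  have box : ∀ y, ∃ e : OpenPartialHomeomorph (C × ℝ) Y, y ∈ e.target ∧
      (∀ q, e q = γ q.1 q.2) ∧ ∀ p ∈ e.source, ∀ q ∈ e.source, |q.2 - p.2| < ε := by
    intro y
    obtain ⟨p, hp⟩ := hC.2.1 y
    obtain ⟨e, hpe, he⟩ := hC.2.2 p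
    have hye : e p = y := by rw [← he]; exact hp
    have ho : IsOpen (Prod.snd ⁻¹' Metric.ball p.2 (ε / 2) : Set (C × ℝ)) :=
      Metric.isOpen_ball.preimage continuous_snd
    refine ⟨e.restrOpen _ ho, ?_, fun q => (congrFun he q).symm, ?_⟩
    · have : p ∈ (e.restrOpen _ ho).source := ⟨hpe, Metric.mem_ball_self (half_pos hε)⟩
      have := (e.restrOpen _ ho).map_source this
      rwa [OpenPartialHomeomorph.coe_restrOpen, hye] at this
    · rintro q ⟨-, hq⟩ r ⟨-, hr⟩
      rw [← Real.dist_eq]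
      have h1 : dist q.2 p.2 < ε / 2 := hq
      have h2 : dist r.2 p.2 < ε / 2 := hr
      linarith [dist_triangle_right r.2 q.2 p.2]
  choose e hye heγ hes using box
  obtain ⟨δ, hδ, h⟩ := lebesgue_number_lemma_of_metric isCompact_univ
    (fun y => (e y).open_target) (fun y _ => mem_iUnion.2 ⟨y, hye y⟩)
  refine ⟨δ, hδ, fun A hA z hAz a ha b hb => ?_⟩
  obtain ⟨y, hy⟩ := h z (mem_univ z)
  have hAt : A ⊆ (e y).target := hAz.trans hy
  have hpre : IsPreconnected ((fun w => (((e y).symm w).1 : Y)) '' A) := by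
    refine hA.image _ ?_
    exact (continuous_subtype_val.comp continuous_fst).comp_continuousOn
      ((e y).continuousOn_symm.mono hAt)
  have hss := hCtd _ (by rintro _ ⟨w, -, rfl⟩; exact ((e y).symm w).1.2) hpre
  have hab := hss (mem_image_of_mem _ ha) (mem_image_of_mem _ hb)
  refine ⟨((e y).symm b).2 - ((e y).symm a).2,
    hes y _ ((e y).map_target (hAt ha)) _ ((e y).map_target (hAt hb)), ?_⟩
  have h1 := (e y).right_inv (hAt ha)
  have h2 := (e y).right_inv (hAt hb)
  rw [heγ] at h1 h2
  rw [← hab] at h2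
  generalize ((e y).symm a).2 = t at *
  rw [← h1, hγ.2.1, add_sub_cancel, h2]

/-- For a flow with a totally disconnected cross section, homotopies move points along orbits,
with continuous flow times. -/
theorem IsCrossSection.exists_time_of_homotopy {Y : Type*} [MetricSpace Y] [CompactSpace Y]
    {γ : Y → ℝ → Y} {C : Set Y} (hC : IsCrossSection γ C) (hγ : IsFlow γ)
    (hCtd : IsTotallyDisconnected C) {X : Type*} [MetricSpace X] [CompactSpace X]
    {H : X → ℝ → Y} (hH : ContinuousOn (fun p : X × ℝ => H p.1 p.2) (univ ×ˢ Icc 0 1)) :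
    ∃ β : X → ℝ, Continuous β ∧ ∀ x, γ (H x 0) (β x) = H x 1 := by
  obtain ⟨ε, hε, hper⟩ := hC.exists_period_bound hγ
  obtain ⟨δ, hδ, hshort⟩ := hC.exists_short_time hγ hCtd (ε := ε / 3) (by positivity)
  obtain ⟨η, hη, hunif⟩ := Metric.uniformContinuousOn_iff.1
    ((isCompact_univ.prod isCompact_Icc).uniformContinuousOn_of_continuous hH) δ hδ
  obtain ⟨N, hN⟩ := exists_nat_one_div_lt hη
  have hHs : ∀ s ∈ Icc (0 : ℝ) 1, Continuous fun x => H x s := fun s hs =>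
    hH.comp_continuous (continuous_id.prodMk continuous_const) fun x => ⟨mem_univ _, hs⟩
  have hHx : ∀ x, ContinuousOn (H x) (Icc 0 1) := fun x =>
    hH.comp (continuous_const.prodMk continuous_id).continuousOn fun s hs => ⟨mem_univ _, hs⟩
  have hN0 : (0 : ℝ) < N + 1 := by positivity
  have step : ∀ n : ℕ, n ≤ N + 1 →
      ∃ β : X → ℝ, Continuous β ∧ ∀ x, γ (H x 0) (β x) = H x (n / (N + 1)) := by
    intro n
    induction n with
    | zero => exact fun _ => ⟨fun _ => 0, continuous_const, fun x => by simp [hγ.2.2.1]⟩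
    | succ n ih =>
      intro hn
      obtain ⟨β, hβ, hβH⟩ := ih (by omega)
      have hn' : (n : ℝ) + 1 ≤ N + 1 := by exact_mod_cast hn
      have hsub : Icc ((n : ℝ) / (N + 1)) ((n + 1) / (N + 1)) ⊆ Icc 0 1 :=
        Icc_subset_Icc (by positivity) ((div_le_one hN0).2 hn')
      have hle : (n : ℝ) / (N + 1) ≤ (n + 1) / (N + 1) := by gcongr; linarith
      have hl := left_mem_Icc.2 hle
      have hr := right_mem_Icc.2 hle
      obtain ⟨τ, hτ, hτH⟩ := hγ.exists_continuous_time hper (hHs _ (hsub hl)) (hHs _ (hsub hr))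
        (fun x => hshort (H x '' Icc ((n : ℝ) / (N + 1)) ((n + 1) / (N + 1)))
          (isPreconnected_Icc.image _ ((hHx x).mono hsub)) (H x (n / (N + 1))) (by
            rintro _ ⟨s, hs, rfl⟩
            refine hunif (x, s) ⟨mem_univ _, hsub hs⟩ (x, (n : ℝ) / (N + 1))
              ⟨mem_univ _, hsub hl⟩ ?_
            rw [Prod.dist_eq, dist_self, max_eq_right dist_nonneg]
            refine lt_of_le_of_lt ?_ hN
            rw [Real.dist_eq, abs_of_nonneg (by linarith [hs.1])]
            have := hs.2
            rw [add_div] at this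
            linarith) _ (mem_image_of_mem _ hl) _ (mem_image_of_mem _ hr))
      refine ⟨fun x => β x + τ x, hβ.add hτ, fun x => ?_⟩
      rw [← hγ.2.1, hβH, hτH]
      push_cast
      rfl
  obtain ⟨β, hβ, hβH⟩ := step (N + 1) le_rfl
  refine ⟨β, hβ, fun x => ?_⟩
  rw [hβH]
  push_cast
  rw [div_self hN0.ne']

end ReparametrizationOfFlows

/-- Proposition 7.1 of the paper: for a flow with a totally disconnected cross section, an
isotopically trivial self flow equivalence of a compact invariant subflow extends to an
isotopically trivial self flow equivalence of the whole flow. -/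
theorem extend_isotopically_trivial {Y : Type*} [MetricSpace Y] [CompactSpace Y]
    (γ : Y → ℝ → Y) (hγ : IsFlow γ)
    (C₀ : Set Y) (hC₀ : IsCrossSection γ C₀) (hC₀td : IsTotallyDisconnected C₀)
    (Y' : Set Y) (hY'ne : Y'.Nonempty) (hY'cp : IsCompact Y')
    (hY'inv : ∀ y ∈ Y', ∀ t : ℝ, γ y t ∈ Y')
    (γ' : Y' → ℝ → Y') (hγ'res : ∀ (y : Y') (t : ℝ), ((γ' y t : Y)) = γ (y : Y) t)
    (χ : Y' → Y') (hχ : MemHomeoPlusIso γ' χ) :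
    ∃ χt : Y → Y, (∀ y : Y', χt (y : Y) = ((χ y : Y') : Y)) ∧ MemHomeoPlusIso γ χt := by
  have hres : IsFlow γ' := by
    refine ⟨?_, fun y s t => ?_, fun y => ?_, fun y => ?_⟩
    · refine Continuous.subtype_mk (hγ.continuous_comp (continuous_subtype_val.comp continuous_fst)
        continuous_snd) (fun p => hY'inv p.1 p.1.2 p.2) |>.congr fun p => ?_
      exact Subtype.ext (hγ'res _ _).symm
    · exact Subtype.ext (by simp only [hγ'res, hγ.2.1])
    · exact Subtype.ext (by simp only [hγ'res, hγ.2.2.1])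
    · obtain ⟨t, ht⟩ := hγ.2.2.2 y
      exact ⟨t, fun h => ht ((hγ'res y t).symm.trans (congrArg Subtype.val h))⟩
  have : CompactSpace Y' := isCompact_iff_compactSpace.1 hY'cp
  obtain ⟨⟨⟨⟨-, -, hloc⟩, -⟩, -⟩, H, hH, -, hH0, hH1⟩ := hχ
  obtain ⟨β, hβ, hβH⟩ := hC₀.exists_time_of_homotopy hγ hC₀td
    (H := fun y s => ((H y s : Y') : Y)) (continuous_subtype_val.comp_continuousOn hH)
  have hβχ : ∀ y, γ' y (β y) = χ y := fun y => Subtype.ext (by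
    rw [hγ'res, ← hH1, ← hβH, hH0])
  obtain ⟨ε, hε, hper⟩ := hC₀.exists_period_bound hγ
  have hmono := hres.strictMono_time hε
    (fun y t ht h => hper y t ht ((hγ'res y t).symm.trans (congrArg Subtype.val h))) hβ
    (by simpa only [hβχ] using hloc)
  obtain ⟨b, hb, hbβ, hbmono⟩ := hγ.exists_extension hY'cp.isClosed hY'ne hY'inv hβ (by
    intro y
    have hyt : ∀ t, (⟨γ y t, hY'inv y y.2 t⟩ : Y') = γ' y t := fun t =>
      Subtype.ext (hγ'res y t).symm
    simpa only [hyt] using hmono y)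
  refine ⟨fun y => γ y (b y), fun y => ?_, hγ.memHomeoPlusIso hb hbmono⟩
  simp only [← hβχ, hγ'res, hbβ]
end

section
/- Suppose γ is a flow on a compact metric space Y which admits a totally disconnected cross section; Y' ⊆ Y is a nonempty compact invariant subset; and C' is a totally disconnected cross section for the restricted flow on Y'. Then there is a cross section C for the flow on Y such that C ∩ Y' = C'. -/
open Set Topology

section LocalSections

variable {Y : Type*} {γ : Y → ℝ → Y} {K L : Set Y}

/-- The points reached from `K` in time less than `δ`, in either direction. -/
def flowThickening (γ : Y → ℝ → Y) (K : Set Y) (δ : ℝ) : Set Y :=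
  {z | ∃ y ∈ K, ∃ t : ℝ, |t| < δ ∧ γ y t = z}

theorem flowThickening_mono {δ ε : ℝ} (hKL : K ⊆ L) (h : δ ≤ ε) :
    flowThickening γ K δ ⊆ flowThickening γ L ε :=
  fun _ ⟨y, hy, t, ht, e⟩ => ⟨y, hKL hy, t, ht.trans_le h, e⟩

/-- Distinct visits of an orbit to `K` are at least `ε` apart. -/
def IsFlowSeparated (γ : Y → ℝ → Y) (K : Set Y) (ε : ℝ) : Prop :=
  ∀ x ∈ K, ∀ t : ℝ, |t| < ε → γ x t ∈ K → t = 0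

theorem IsFlowSeparated.mono {ε : ℝ} (h : IsFlowSeparated γ K ε) (hL : L ⊆ K) :
    IsFlowSeparated γ L ε :=
  fun x hx t ht hxt => h x (hL hx) t ht (hL hxt)

variable [TopologicalSpace Y]

namespace IsFlow

theorem continuous_time (hγ : IsFlow γ) (t : ℝ) : Continuous fun y => γ y t :=
  hγ.1.comp (by fun_prop : Continuous fun y : Y => (y, t))

theorem map_neg (hγ : IsFlow γ) {y z : Y} {t : ℝ} (h : γ y t = z) : γ z (-t) = y := by
  rw [← h, hγ.2.1, add_neg_cancel, hγ.2.2.1]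

theorem map_sub (hγ : IsFlow γ) {y z : Y} {s t : ℝ} (h : γ y s = γ z t) :
    γ y (s - t) = z := by
  rw [sub_eq_add_neg, ← hγ.2.1]
  exact hγ.map_neg h.symm

theorem restrict (hγ : IsFlow γ) {Z : Set Y} {γ' : Z → ℝ → Z}
    (h : ∀ (y : Z) (t : ℝ), (γ' y t : Y) = γ y t) : IsFlow γ' := by
  refine ⟨?_, fun y s t => ?_, fun y => ?_, fun y => ?_⟩
  · refine continuous_induced_rng.2 ((hγ.1.comp (by fun_prop : Continuous
      fun p : Z × ℝ => ((p.1 : Y), p.2))).congr fun p => (h p.1 p.2).symm)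
  · exact Subtype.ext (by rw [h, h, h, hγ.2.1])
  · exact Subtype.ext (by rw [h, hγ.2.2.1])
  · obtain ⟨t, ht⟩ := hγ.2.2.2 y
    exact ⟨t, fun h' => ht (by rw [← h, h'])⟩

/-- The flow moves a compact set off a disjoint closed set for a uniform amount of time. -/
theorem exists_forall_notMem (hγ : IsFlow γ) (hK : IsCompact K) (hL : IsClosed L)
    (hKL : Disjoint K L) : ∃ ε > 0, ∀ x ∈ K, ∀ t : ℝ, |t| < ε → γ x t ∉ L := by
  have h : ∀ᶠ t in 𝓝 (0 : ℝ), ∀ x ∈ K, γ x t ∉ L := by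
    refine hK.eventually_forall_of_forall_eventually fun x hx => ?_
    refine (hγ.1.comp continuous_swap).continuousAt.eventually_mem (hL.isOpen_compl.mem_nhds ?_)
    simpa [hγ.2.2.1] using disjoint_left.1 hKL hx
  obtain ⟨ε, hε, h⟩ := Metric.eventually_nhds_iff.1 h
  exact ⟨ε, hε, fun x hx t ht => h (by simpa using ht) x hx⟩

end IsFlow

/-- A closed set transverse to the flow, which need not meet every orbit. -/
structure IsLocalSection (γ : Y → ℝ → Y) (K : Set Y) : Prop where
  isClosed : IsClosed K
  separated : ∃ ε > 0, IsFlowSeparated γ K ε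
  thickening_mem_nhds : ∀ x ∈ K, ∀ δ > 0, flowThickening γ K δ ∈ 𝓝 x

theorem IsFlowSeparated.eq_of_mem (hγ : IsFlow γ) {ε s t : ℝ} (h : IsFlowSeparated γ K ε)
    {y : Y} (hs : γ y s ∈ K) (ht : γ y t ∈ K) (hst : |t - s| < ε) : s = t := by
  have := h _ hs (t - s) hst (by rwa [hγ.2.1, add_sub_cancel])
  linarith

theorem isLocalSection_empty : IsLocalSection γ (∅ : Set Y) :=
  ⟨isClosed_empty, ⟨1, one_pos, fun _ h => h.elim⟩, fun _ h => h.elim⟩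

theorem exists_relClopen_between [CompactSpace Y] [T2Space Y] (hK : IsClosed K)
    (hKtd : IsTotallyDisconnected K) {A U : Set Y} (hA : IsClosed A) (hAK : A ⊆ K)
    (hU : IsOpen U) (hAU : A ⊆ U) :
    ∃ E, IsClosed E ∧ IsClosed (K \ E) ∧ A ⊆ E ∧ E ⊆ K ∧ E ⊆ U := by
  have := totallyDisconnectedSpace_subtype_iff.2 hKtd
  have := isCompact_iff_compactSpace.1 hK.isCompact
  obtain ⟨C, hC, hAC, hCU⟩ := exists_clopen_of_closed_subset_open
    (hA.preimage (continuous_subtype_val (p := (· ∈ K))))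
    (hU.preimage (continuous_subtype_val (p := (· ∈ K)))) (preimage_mono hAU)
  refine ⟨Subtype.val '' C, hK.isClosedEmbedding_subtypeVal.isClosedMap _ hC.1, ?_, ?_, ?_, ?_⟩
  · convert hK.isClosedEmbedding_subtypeVal.isClosedMap _ hC.compl.1 using 1
    ext x
    simp
  · exact fun x hx => ⟨⟨x, hAK hx⟩, hAC hx, rfl⟩
  · rintro _ ⟨x, -, rfl⟩
    exact x.2
  · rintro _ ⟨x, hx, rfl⟩
    exact hCU hx

theorem IsTotallyDisconnected.union_of_disjoint_closed (hK : IsTotallyDisconnected K)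
    (hL : IsTotallyDisconnected L) (hKc : IsClosed K) (hLc : IsClosed L) (h : Disjoint K L) :
    IsTotallyDisconnected (K ∪ L) := by
  intro t ht htc
  rcases isPreconnected_iff_subset_of_disjoint_closed.1 htc K L hKc hLc ht
    (by rw [h.inter_eq, inter_empty]) with h' | h'
  exacts [hK t h' htc, hL t h' htc]

/-- A cross section is transverse to the flow. -/
theorem IsCrossSection.isLocalSection [CompactSpace Y] (hγ : IsFlow γ)
    (hK : IsCrossSection γ K) : IsLocalSection γ K := by
  obtain ⟨hc, -, hl⟩ := hK
  refine ⟨hc, ?_, fun x hx δ hδ => ?_⟩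
  · have h : ∀ᶠ t in 𝓝 (0 : ℝ), ∀ x ∈ K, x ∈ K → γ x t ∈ K → t = 0 := by
      refine hc.isCompact.eventually_forall_of_forall_eventually fun x hx => ?_
      obtain ⟨U, hUo, hxU, hU⟩ := hl.isLocallyInjective (⟨x, hx⟩, 0)
      obtain ⟨V, hV, W, hW, hVW⟩ := mem_nhds_prod_iff.1 (hUo.mem_nhds hxU)
      obtain ⟨V', hV', hVV'⟩ := mem_nhds_induced _ _ _ |>.1 hV
      have h1 : ∀ᶠ p : ℝ × Y in 𝓝 (0, x), p.2 ∈ V' :=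
        continuousAt_snd.eventually_mem hV'
      have h2 : ∀ᶠ p : ℝ × Y in 𝓝 (0, x), p.1 ∈ W :=
        continuousAt_fst.eventually_mem hW
      have h3 : ∀ᶠ p : ℝ × Y in 𝓝 (0, x), γ p.2 p.1 ∈ V' :=
        (hγ.1.comp continuous_swap).continuousAt.eventually_mem (by simpa [hγ.2.2.1] using hV')
      filter_upwards [h1, h2, h3] with p h1 h2 h3 hpK hp
      have := hU (x₁ := (⟨p.2, hpK⟩, p.1)) (x₂ := (⟨γ p.2 p.1, hp⟩, 0))
        (hVW ⟨hVV' h1, h2⟩) (hVW ⟨hVV' h3, mem_of_mem_nhds hW⟩) (by simp [hγ.2.2.1])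
      exact (Prod.ext_iff.1 this).2
    obtain ⟨ε, hε, h⟩ := Metric.eventually_nhds_iff.1 h
    exact ⟨ε, hε, fun x hx t ht => h (by simpa using ht) x hx hx⟩
  · have := hl.isOpenMap.image_mem_nhds (x := (⟨x, hx⟩, 0))
      (s := univ ×ˢ Metric.ball 0 δ) (prod_mem_nhds Filter.univ_mem (Metric.ball_mem_nhds _ hδ))
    simp only [hγ.2.2.1] at this
    filter_upwards [this]
    rintro _ ⟨⟨y, t⟩, ⟨-, ht⟩, rfl⟩
    exact ⟨y, y.2, t, by simpa using ht, rfl⟩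

namespace IsLocalSection

/-- Transversality localizes: only the points of `K` close to `x` matter near `x`. -/
theorem thickening_inter_mem_nhds [CompactSpace Y] [T2Space Y] (hγ : IsFlow γ)
    (hK : IsLocalSection γ K) {x : Y} (hx : x ∈ K) {U : Set Y} (hU : U ∈ 𝓝 x) {δ : ℝ}
    (hδ : 0 < δ) : flowThickening γ (K ∩ U) δ ∈ 𝓝 x := by
  obtain ⟨ε, hε, hsep⟩ := hK.separated
  obtain ⟨V, hVU, hVo, hxV⟩ := mem_nhds_iff.1 hU
  set η := min δ (ε / 2) with hη
  have hη0 : 0 < η := lt_min hδ (by linarith)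
  have hηε : η < ε := (min_le_right _ _).trans_lt (by linarith)
  have hcomp : IsCompact ((fun p : Y × ℝ => γ p.1 p.2) '' ((K \ V) ×ˢ Icc (-η) η)) :=
    ((hK.isClosed.sdiff hVo).isCompact.prod isCompact_Icc).image hγ.1
  have hnot : x ∉ (fun p : Y × ℝ => γ p.1 p.2) '' ((K \ V) ×ˢ Icc (-η) η) := by
    rintro ⟨⟨y, t⟩, ⟨⟨hyK, hyV⟩, ht⟩, e⟩
    dsimp only at e
    have : t = 0 := hsep y hyK t ((abs_le.2 ht).trans_lt hηε) (e ▸ hx)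
    rw [this, hγ.2.2.1] at e
    exact hyV (e ▸ hxV)
  filter_upwards [hK.thickening_mem_nhds x hx η hη0, hcomp.isClosed.isOpen_compl.mem_nhds hnot]
  rintro _ ⟨y, hy, t, ht, rfl⟩ hn
  refine ⟨y, ⟨hy, hVU ?_⟩, t, ht.trans_le (min_le_left _ _), rfl⟩
  by_contra hyV
  exact hn ⟨(y, t), ⟨⟨hy, hyV⟩, abs_le.1 ht.le⟩, rfl⟩

theorem of_relClopen [CompactSpace Y] [T2Space Y] (hγ : IsFlow γ) (hK : IsLocalSection γ K)
    (hLK : L ⊆ K) (hL : IsClosed L) (hKL : IsClosed (K \ L)) : IsLocalSection γ L := by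
  refine ⟨hL, ?_, fun x hx δ hδ => ?_⟩
  · obtain ⟨ε, hε, h⟩ := hK.separated
    exact ⟨ε, hε, h.mono hLK⟩
  · refine Filter.mem_of_superset (hK.thickening_inter_mem_nhds hγ (hLK hx)
      (hKL.isOpen_compl.mem_nhds fun h => h.2 hx) hδ) (flowThickening_mono ?_ le_rfl)
    exact fun y ⟨hy, hy'⟩ => by_contra fun h => hy' ⟨hy, h⟩

theorem union [CompactSpace Y] (hγ : IsFlow γ) (hK : IsLocalSection γ K)
    (hL : IsLocalSection γ L) (h : Disjoint K L) : IsLocalSection γ (K ∪ L) := by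
  refine ⟨hK.isClosed.union hL.isClosed, ?_, ?_⟩
  · obtain ⟨ε₁, h₁, hK'⟩ := hK.separated
    obtain ⟨ε₂, h₂, hL'⟩ := hL.separated
    obtain ⟨ε₃, h₃, hKL⟩ := hγ.exists_forall_notMem hK.isClosed.isCompact hL.isClosed h
    obtain ⟨ε₄, h₄, hLK⟩ := hγ.exists_forall_notMem hL.isClosed.isCompact hK.isClosed h.symm
    refine ⟨min (min ε₁ ε₂) (min ε₃ ε₄), by positivity, ?_⟩
    intro x hx t ht hxt
    simp only [lt_min_iff] at ht
    rcases hx with hx | hx <;> rcases hxt with hxt | hxt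
    exacts [hK' x hx t ht.1.1 hxt, absurd hxt (hKL x hx t ht.2.1),
      absurd hxt (hLK x hx t ht.2.2), hL' x hx t ht.1.2 hxt]
  · rintro x (hx | hx) δ hδ
    · exact Filter.mem_of_superset (hK.thickening_mem_nhds x hx δ hδ)
        (flowThickening_mono subset_union_left le_rfl)
    · exact Filter.mem_of_superset (hL.thickening_mem_nhds x hx δ hδ)
        (flowThickening_mono subset_union_right le_rfl)

theorem injOn_graph (hγ : IsFlow γ) {ε t₀ : ℝ} (hsep : IsFlowSeparated γ K ε) {T : Y → ℝ}
    (hT : ∀ y ∈ K, |T y - t₀| < ε / 3) : InjOn (fun y => γ y (T y)) K := by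
  intro x hx y hy h
  have hxy := hγ.map_sub h
  have h1 := abs_lt.1 (hT x hx)
  have h2 := abs_lt.1 (hT y hy)
  have h0 := hsep x hx (T x - T y) (abs_lt.2 ⟨by linarith, by linarith⟩) (by rwa [hxy])
  rwa [h0, hγ.2.2.1] at hxy

/-- Pushing a local section along the flow by a continuous, nearly constant time yields a local
section. -/
theorem graph [CompactSpace Y] [T2Space Y] (hγ : IsFlow γ) (hK : IsLocalSection γ K)
    {ε t₀ : ℝ} (hε : 0 < ε) (hsep : IsFlowSeparated γ K ε) {T : Y → ℝ} (hTc : Continuous T)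
    (hT : ∀ y ∈ K, |T y - t₀| < ε / 3) : IsLocalSection γ ((fun y => γ y (T y)) '' K) := by
  have hcont : Continuous fun y => γ y (T y) :=
    hγ.1.comp (by fun_prop : Continuous fun y : Y => (y, T y))
  refine ⟨(hK.isClosed.isCompact.image hcont).isClosed, ⟨ε / 3, by positivity, ?_⟩, ?_⟩
  · rintro _ ⟨x, hx, rfl⟩ t ht ⟨y, hy, hxy⟩
    dsimp only at hxy
    rw [hγ.2.1] at hxy
    have hxy := hγ.map_sub hxy.symm
    have h1 := abs_lt.1 (hT x hx)
    have h2 := abs_lt.1 (hT y hy)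
    have h3 := abs_lt.1 ht
    have h0 := hsep x hx (T x + t - T y) (abs_lt.2 ⟨by linarith, by linarith⟩) (by rwa [hxy])
    rw [h0, hγ.2.2.1] at hxy
    subst hxy
    linarith
  · rintro _ ⟨x, hx, rfl⟩ δ hδ
    have hU : {y | |T y - T x| < δ / 2} ∈ 𝓝 x := by
      have := hTc.continuousAt.eventually_mem (Metric.ball_mem_nhds (T x) (half_pos hδ))
      filter_upwards [this] with y hy
      rwa [Metric.mem_ball, Real.dist_eq] at hy
    have hback : Filter.Tendsto (fun z => γ z (-T x)) (𝓝 (γ x (T x))) (𝓝 x) := by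
      have := (hγ.continuous_time (-T x)).tendsto (γ x (T x))
      rwa [hγ.map_neg rfl] at this
    filter_upwards [hback (hK.thickening_inter_mem_nhds hγ hx hU (half_pos hδ))]
    rintro z ⟨y, ⟨hy, hyU⟩, t, ht, e⟩
    refine ⟨_, ⟨y, hy, rfl⟩, t + T x - T y, ?_, ?_⟩
    · have h1 := abs_lt.1 (show |T y - T x| < δ / 2 from hyU)
      have h2 := abs_lt.1 ht
      exact abs_lt.2 ⟨by linarith, by linarith⟩
    · have := hγ.map_neg e.symm
      rw [neg_neg, hγ.2.1] at this
      rw [hγ.2.1, ← this]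
      congr 1
      ring

theorem isTotallyDisconnected_graph [CompactSpace Y] [T2Space Y] (hγ : IsFlow γ)
    (hK : IsClosed K) (hKtd : IsTotallyDisconnected K) {ε t₀ : ℝ}
    (hsep : IsFlowSeparated γ K ε) {T : Y → ℝ} (hTc : Continuous T)
    (hT : ∀ y ∈ K, |T y - t₀| < ε / 3) :
    IsTotallyDisconnected ((fun y => γ y (T y)) '' K) := by
  have := isCompact_iff_compactSpace.1 hK.isCompact
  have hcont : Continuous fun y => γ y (T y) :=
    hγ.1.comp (by fun_prop : Continuous fun y : Y => (y, T y))
  have hemb := (hcont.comp (continuous_subtype_val (p := (· ∈ K)))).isClosedEmbedding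
    (injOn_graph hγ hsep hT).injective
  have := hemb.isEmbedding.isTotallyDisconnected_range.2
    (totallyDisconnectedSpace_subtype_iff.2 hKtd)
  rwa [range_comp, Subtype.range_val] at this

theorem isCrossSection [CompactSpace Y] [T2Space Y] (hγ : IsFlow γ) (hK : IsLocalSection γ K)
    (hs : ∀ z, ∃ y ∈ K, ∃ t, γ y t = z) : IsCrossSection γ K := by
  have hcont : Continuous fun p : K × ℝ => γ p.1.1 p.2 :=
    hγ.1.comp (by fun_prop : Continuous fun p : K × ℝ => ((p.1 : Y), p.2))
  have hopen : IsOpenMap fun p : K × ℝ => γ p.1.1 p.2 := by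
    refine isOpenMap_iff_nhds_le.2 ?_
    rintro ⟨⟨x, hx⟩, t⟩ s hs
    obtain ⟨V, hV, W, hW, hVW⟩ := mem_nhds_prod_iff.1 hs
    obtain ⟨U, hU, hUV⟩ := mem_nhds_induced _ _ _ |>.1 hV
    obtain ⟨δ, hδ, hδW⟩ := Metric.mem_nhds_iff.1 hW
    have hback : Filter.Tendsto (fun z => γ z (-t)) (𝓝 (γ x t)) (𝓝 x) := by
      have := (hγ.continuous_time (-t)).tendsto (γ x t)
      rwa [hγ.map_neg rfl] at this
    filter_upwards [hback (hK.thickening_inter_mem_nhds hγ hx hU hδ)]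
    rintro z ⟨y, ⟨hy, hyU⟩, r, hr, e⟩
    have hz := hγ.map_neg e.symm
    rw [neg_neg, hγ.2.1] at hz
    rw [← hz]
    exact @hVW (⟨y, hy⟩, r + t) ⟨hUV hyU, hδW (by simpa [Real.dist_eq] using hr)⟩
  refine ⟨hK.isClosed, fun z => ?_, ?_⟩
  · obtain ⟨y, hy, t, e⟩ := hs z
    exact ⟨(⟨y, hy⟩, t), e⟩
  · refine isLocalHomeomorph_iff_isOpenEmbedding_restrict.2 fun p => ?_
    obtain ⟨ε, hε, hsep⟩ := hK.separated
    have hO : IsOpen (univ ×ˢ Metric.ball p.2 (ε / 2) : Set (K × ℝ)) :=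
      isOpen_univ.prod Metric.isOpen_ball
    refine ⟨_, hO.mem_nhds ⟨trivial, Metric.mem_ball_self (half_pos hε)⟩,
      .of_continuous_injective_isOpenMap (hcont.comp continuous_subtype_val) ?_
        (hopen.domRestrict hO)⟩
    refine injOn_iff_injective.1 ?_
    rintro ⟨⟨x, hx⟩, s⟩ ⟨-, hs⟩ ⟨⟨y, hy⟩, t⟩ ⟨-, ht⟩ e
    simp only [Metric.mem_ball, Real.dist_eq, abs_lt] at hs ht
    have hxy := hγ.map_sub e
    dsimp only at hxy
    have h0 := hsep x hx (s - t) (abs_lt.2 ⟨by linarith, by linarith⟩) (by rwa [hxy])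
    rw [h0, hγ.2.2.1] at hxy
    subst hxy
    rw [sub_eq_zero.1 h0]

/-- Near each of its points, a section of an invariant subset `Z` extends to a local section of
the ambient flow, provided the point lies on a totally disconnected local section. -/
theorem exists_local_extension [CompactSpace Y] [T2Space Y] (hγ : IsFlow γ) {Z C B : Set Y}
    (hZ : IsClosed Z) (hZinv : ∀ y ∈ Z, ∀ t, γ y t ∈ Z) (hCZ : C ⊆ Z)
    {ε : ℝ} (hε : 0 < ε) (hCsep : IsFlowSeparated γ C ε)
    (hC : ∀ x ∈ C, ∀ δ > 0, flowThickening γ C δ ∈ 𝓝[Z] x)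
    (hB : IsLocalSection γ B) (hBtd : IsTotallyDisconnected B) {x : Y} (hxC : x ∈ C)
    (hxB : x ∈ B) :
    ∃ K, IsLocalSection γ K ∧ IsTotallyDisconnected K ∧ K ∩ Z ⊆ C ∧ K ∈ 𝓝[C] x := by
  obtain ⟨ε', hε', hBsep⟩ := hB.separated
  obtain ⟨δ, hδ0, hδε, hδε'⟩ : ∃ δ > 0, 3 * δ < ε ∧ δ < ε' / 3 := by
    refine ⟨min ε ε' / 4, by positivity, ?_, ?_⟩
    · linarith [min_le_left ε ε']
    · linarith [min_le_right ε ε']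
  obtain ⟨N, hNo, hxN, hN⟩ := mem_nhdsWithin.1 (hC x hxC δ hδ0)
  obtain ⟨E, hEc, hBE, hxE, hEB, hEN⟩ := exists_relClopen_between hB.isClosed hBtd
    isClosed_singleton (singleton_subset_iff.2 hxB) hNo (singleton_subset_iff.2 hxN)
  have hE := hB.of_relClopen hγ hEB hEc hBE
  have hEsep := hBsep.mono hEB
  have hτ : ∀ b : ↥(E ∩ Z), ∃ s ∈ Ioo (-δ) δ, γ b s ∈ C := by
    rintro ⟨b, hbE, hbZ⟩
    obtain ⟨y, hy, t, ht, e⟩ := hN ⟨hEN hbE, hbZ⟩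
    refine ⟨-t, abs_lt.1 (by rwa [abs_neg]), ?_⟩
    rwa [hγ.map_neg e]
  choose τ hτδ hτC using hτ
  have hτc : Continuous τ := by
    refine continuous_iff_continuousAt.2 fun b => Metric.continuousAt_iff'.2 fun η hη => ?_
    have hlim : Filter.Tendsto (fun b' : ↥(E ∩ Z) => γ b' (τ b)) (𝓝 b) (𝓝[Z] (γ b (τ b))) :=
      tendsto_nhdsWithin_iff.2 ⟨((hγ.continuous_time (τ b)).comp continuous_subtype_val).tendsto b,
        .of_forall fun b' => hZinv _ b'.2.2 _⟩
    filter_upwards [hlim (hC _ (hτC b) (min η δ) (lt_min hη hδ0))]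
    rintro b' ⟨y, hy, t, ht, e⟩
    obtain ⟨ht1, ht2⟩ := lt_min_iff.1 ht
    have hb' := hγ.map_neg e
    rw [hγ.2.1] at hb'
    have h1 := hτδ b
    have h2 := hτδ b'
    have h3 := abs_lt.1 ht2
    have := hCsep.eq_of_mem hγ (hb'.symm ▸ hy) (hτC b')
      (abs_lt.2 ⟨by linarith [h1.1, h1.2, h2.1, h2.2], by linarith [h1.1, h1.2, h2.1, h2.2]⟩)
    rw [Real.dist_eq, ← this]
    simpa using ht1
  obtain ⟨T, hTδ, hTτ⟩ := ContinuousMap.exists_restrict_eq_forall_mem_of_closed ⟨τ, hτc⟩ hτδ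
    ⟨0, by simpa using hδ0⟩ (hEc.inter hZ)
  have hTτ' : ∀ b (hb : b ∈ E ∩ Z), T b = τ ⟨b, hb⟩ :=
    fun b hb => DFunLike.congr_fun hTτ ⟨b, hb⟩
  have hT : ∀ y ∈ E, |T y - 0| < ε' / 3 := fun y _ => by
    rw [sub_zero]
    exact (abs_lt.2 (hTδ y)).trans hδε'
  refine ⟨_, hE.graph hγ hε' hEsep T.continuous hT,
    isTotallyDisconnected_graph hγ hEc (fun t ht => hBtd t (ht.trans hEB)) hEsep
      T.continuous hT, ?_, ?_⟩
  · rintro _ ⟨⟨b, hb, rfl⟩, hbZ⟩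
    have hbZ' : b ∈ Z := by
      have := hZinv _ hbZ (-T b)
      rwa [hγ.map_neg rfl] at this
    have := hτC ⟨b, hb, hbZ'⟩
    rwa [← hTτ' b ⟨hb, hbZ'⟩] at this
  · filter_upwards [mem_nhdsWithin_of_mem_nhds
      (hE.thickening_mem_nhds x (singleton_subset_iff.1 hxE) δ hδ0), self_mem_nhdsWithin]
    rintro y ⟨b, hb, s, hs, e⟩ hy
    have hbZ : b ∈ Z := hγ.map_neg e ▸ hZinv _ (hCZ hy) _
    have h1 := hτδ ⟨b, hb, hbZ⟩
    have h2 := abs_lt.1 hs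
    have := hCsep.eq_of_mem hγ (e.symm ▸ hy) (hτC ⟨b, hb, hbZ⟩)
      (abs_lt.2 ⟨by linarith [h1.1], by linarith [h1.2]⟩)
    refine ⟨b, hb, ?_⟩
    dsimp only
    rw [hTτ' b ⟨hb, hbZ⟩, ← this, e]

/-- Two local sections extending parts of `C` can be merged. -/
theorem exists_merge [CompactSpace Y] [T2Space Y] (hγ : IsFlow γ) {Z C : Set Y}
    (hZ : IsClosed Z) (hZinv : ∀ y ∈ Z, ∀ t, γ y t ∈ Z) (hCZ : C ⊆ Z)
    {ε : ℝ} (hε : 0 < ε) (hCsep : IsFlowSeparated γ C ε)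
    (hK : IsLocalSection γ K) (hKtd : IsTotallyDisconnected K) (hKC : K ∩ Z ⊆ C)
    (hL : IsLocalSection γ L) (hLtd : IsTotallyDisconnected L) (hLC : L ∩ Z ⊆ C) :
    ∃ M, IsLocalSection γ M ∧ IsTotallyDisconnected M ∧ M ∩ Z ⊆ C ∧ (K ∪ L) ∩ Z ⊆ M := by
  have hKZ : ∀ x ∈ K ∩ Z, K ∈ 𝓝[C] x := by
    rintro x ⟨hxK, hxZ⟩
    filter_upwards [mem_nhdsWithin_of_mem_nhds (hK.thickening_mem_nhds x hxK ε hε),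
      self_mem_nhdsWithin]
    rintro z ⟨y, hy, t, ht, e⟩ hz
    have hyC : y ∈ C := hKC ⟨hy, hγ.map_neg e ▸ hZinv _ (hCZ hz) _⟩
    have h0 := hCsep y hyC t ht (e.symm ▸ hz)
    rw [h0, hγ.2.2.1] at e
    exact e ▸ hy
  have hA : IsClosed ((L ∩ Z) \ K) := by
    refine isClosed_of_closure_subset fun x hx => ?_
    have hxLZ : x ∈ L ∩ Z := closure_minimal sdiff_subset (hL.isClosed.inter hZ) hx
    refine ⟨hxLZ, fun hxK => ?_⟩
    obtain ⟨U, hU, hUK⟩ := mem_nhdsWithin_iff_exists_mem_nhds_inter.1 (hKZ x ⟨hxK, hxLZ.2⟩)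
    obtain ⟨z, hzU, hzA⟩ := mem_closure_iff_nhds.1 hx U hU
    exact hzA.2 (hUK ⟨hzU, hLC hzA.1⟩)
  obtain ⟨E, hEc, hLE, hAE, hEL, hEK⟩ := exists_relClopen_between hL.isClosed hLtd hA
    (fun x hx => hx.1.1) hK.isClosed.isOpen_compl (fun x hx => hx.2)
  have hdisj : Disjoint K E := disjoint_right.2 hEK
  refine ⟨K ∪ E, hK.union hγ (hL.of_relClopen hγ hEL hEc hLE) hdisj,
    hKtd.union_of_disjoint_closed (fun t ht => hLtd t (ht.trans hEL)) hK.isClosed hEc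
      hdisj, ?_, ?_⟩
  · rintro x ⟨hx | hx, hxZ⟩
    exacts [hKC ⟨hx, hxZ⟩, hLC ⟨hEL hx, hxZ⟩]
  · rintro x ⟨hx | hx, hxZ⟩
    · exact .inl hx
    · by_cases hxK : x ∈ K
      exacts [.inl hxK, .inr (hAE ⟨⟨hx, hxZ⟩, hxK⟩)]

/-- A section of a closed invariant subset extends to a local section of the ambient flow. -/
theorem exists_extension [CompactSpace Y] [T2Space Y] (hγ : IsFlow γ) {Z C C₀ : Set Y}
    (hC₀ : IsLocalSection γ C₀) (hC₀td : IsTotallyDisconnected C₀)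
    (hC₀s : ∀ z, ∃ y ∈ C₀, ∃ t, γ y t = z)
    (hCc : IsClosed C) (hZ : IsClosed Z) (hZinv : ∀ y ∈ Z, ∀ t, γ y t ∈ Z) (hCZ : C ⊆ Z)
    {ε : ℝ} (hε : 0 < ε) (hCsep : IsFlowSeparated γ C ε)
    (hC : ∀ x ∈ C, ∀ δ > 0, flowThickening γ C δ ∈ 𝓝[Z] x) :
    ∃ K, IsLocalSection γ K ∧ K ∩ Z = C := by
  suffices h : ∃ K, IsLocalSection γ K ∧ IsTotallyDisconnected K ∧ K ∩ Z ⊆ C ∧ C ∩ C ⊆ K by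
    obtain ⟨K, hK, -, hKC, hCK⟩ := h
    rw [inter_self] at hCK
    exact ⟨K, hK, hKC.antisymm (subset_inter hCK hCZ)⟩
  refine hCc.isCompact.induction_on (p := fun S => ∃ K, IsLocalSection γ K ∧
    IsTotallyDisconnected K ∧ K ∩ Z ⊆ C ∧ S ∩ C ⊆ K) ?_ ?_ ?_ fun x hx => ?_
  · exact ⟨∅, isLocalSection_empty, isTotallyDisconnected_empty, by simp, by simp⟩
  · rintro S T hST ⟨K, h1, h2, h3, h4⟩
    exact ⟨K, h1, h2, h3, (inter_subset_inter_left _ hST).trans h4⟩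
  · rintro S T ⟨K, hK, hKtd, hKC, hSK⟩ ⟨L, hL, hLtd, hLC, hTL⟩
    obtain ⟨M, hM, hMtd, hMC, hKLM⟩ :=
      exists_merge hγ hZ hZinv hCZ hε hCsep hK hKtd hKC hL hLtd hLC
    refine ⟨M, hM, hMtd, hMC, ?_⟩
    rintro y ⟨hy | hy, hyC⟩
    exacts [hKLM ⟨.inl (hSK ⟨hy, hyC⟩), hCZ hyC⟩, hKLM ⟨.inr (hTL ⟨hy, hyC⟩), hCZ hyC⟩]
  · obtain ⟨ε₀, hε₀, hsep₀⟩ := hC₀.separated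
    obtain ⟨c, hc, t₀, e⟩ := hC₀s x
    have hT : ∀ y ∈ C₀, |t₀ - t₀| < ε₀ / 3 := fun y _ => by simpa using hε₀
    obtain ⟨K, hK, hKtd, hKC, hKx⟩ := exists_local_extension hγ hZ hZinv hCZ hε hCsep hC
      (hC₀.graph hγ hε₀ hsep₀ (T := fun _ => t₀) continuous_const hT)
      (isTotallyDisconnected_graph hγ hC₀.isClosed hC₀td hsep₀ continuous_const hT) hx
      ⟨c, hc, e⟩
    exact ⟨K, hKx, K, hK, hKtd, hKC, inter_subset_left⟩

theorem isOpen_orbits (hγ : IsFlow γ) (hK : IsLocalSection γ K) :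
    IsOpen {z | ∃ y ∈ K, ∃ t, γ y t = z} := by
  refine isOpen_iff_mem_nhds.2 ?_
  rintro _ ⟨x, hx, t, rfl⟩
  have hback : Filter.Tendsto (fun z => γ z (-t)) (𝓝 (γ x t)) (𝓝 x) := by
    have := (hγ.continuous_time (-t)).tendsto (γ x t)
    rwa [hγ.map_neg rfl] at this
  filter_upwards [hback (hK.thickening_mem_nhds x hx 1 one_pos)]
  rintro z ⟨y, hy, r, -, e⟩
  have hz := hγ.map_neg e.symm
  rw [neg_neg, hγ.2.1] at hz
  exact ⟨y, hy, _, hz⟩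

end IsLocalSection

end LocalSections

/-- Proposition 7.2 of the paper: a totally disconnected cross section of a compact invariant
subflow extends to a cross section of the whole flow (which admits a totally disconnected
cross section). -/
theorem extend_cross_section {Y : Type*} [MetricSpace Y] [CompactSpace Y]
    (γ : Y → ℝ → Y) (hγ : IsFlow γ)
    (C₀ : Set Y) (hC₀ : IsCrossSection γ C₀) (hC₀td : IsTotallyDisconnected C₀)
    (Y' : Set Y) (hY'ne : Y'.Nonempty) (hY'cp : IsCompact Y')
    (hY'inv : ∀ y ∈ Y', ∀ t : ℝ, γ y t ∈ Y')
    (γ' : Y' → ℝ → Y') (hγ'res : ∀ (y : Y') (t : ℝ), ((γ' y t : Y)) = γ (y : Y) t)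
    (C' : Set Y) (hC'sub : C' ⊆ Y') (hC'td : IsTotallyDisconnected C')
    (hC'cs : IsCrossSection γ' (Subtype.val ⁻¹' C')) :
    ∃ C : Set Y, IsCrossSection γ C ∧ C ∩ Y' = C' := by
  have hY'cl := hY'cp.isClosed
  have : CompactSpace Y' := isCompact_iff_compactSpace.1 hY'cp
  have hL₀ := hC₀.isLocalSection hγ
  have hC₀s : ∀ z, ∃ y ∈ C₀, ∃ t, γ y t = z := fun z =>
    let ⟨p, hp⟩ := hC₀.2.1 z
    ⟨p.1, p.1.2, p.2, hp⟩
  have hL' := hC'cs.isLocalSection (hγ.restrict hγ'res)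
  have hC'cl : IsClosed C' := by
    have := hY'cl.isClosedEmbedding_subtypeVal.isClosedMap _ hL'.isClosed
    rwa [Subtype.image_preimage_coe, inter_eq_right.2 hC'sub] at this
  obtain ⟨ε, hε, hsep⟩ := hL'.separated
  have hC'sep : IsFlowSeparated γ C' ε := fun x hx t ht hxt =>
    hsep ⟨x, hC'sub hx⟩ hx t ht (by simpa [hγ'res] using hxt)
  have hC'nhds : ∀ x ∈ C', ∀ δ > 0, flowThickening γ C' δ ∈ 𝓝[Y'] x := by
    intro x hx δ hδ
    rw [← map_nhds_subtype_val ⟨x, hC'sub hx⟩]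
    refine Filter.mem_map.2 ?_
    filter_upwards [hL'.thickening_mem_nhds ⟨x, hC'sub hx⟩ hx δ hδ]
    rintro _ ⟨y, hy, t, ht, rfl⟩
    exact ⟨y, hy, t, ht, (hγ'res y t).symm⟩
  obtain ⟨K, hK, hKC'⟩ := IsLocalSection.exists_extension hγ hL₀ hC₀td hC₀s hC'cl hY'cl hY'inv
    hC'sub hε hC'sep hC'nhds
  obtain ⟨E, hEc, hC₀E, hAE, hEC₀, hEK⟩ := exists_relClopen_between hL₀.isClosed hC₀td
    (hL₀.isClosed.inter (hK.isClosed.union hY'cl)) inter_subset_left (hK.isOpen_orbits hγ) (by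
      rintro x ⟨-, hx | hx⟩
      · exact ⟨x, hx, 0, hγ.2.2.1 x⟩
      · obtain ⟨p, hp⟩ := hC'cs.2.1 ⟨x, hx⟩
        refine ⟨p.1.1, (hKC'.symm ▸ p.1.2 : (p.1.1 : Y) ∈ K ∩ Y').1, p.2, ?_⟩
        rw [← hγ'res]
        exact congrArg Subtype.val hp)
  have hD : IsLocalSection γ (C₀ \ E) := hL₀.of_relClopen hγ sdiff_subset hC₀E
    (by rwa [Set.sdiff_sdiff_right_self, inter_eq_right.2 hEC₀])
  have hdisj : Disjoint K (C₀ \ E) :=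
    disjoint_left.2 fun x hx hxD => hxD.2 (hAE ⟨hxD.1, .inl hx⟩)
  refine ⟨K ∪ C₀ \ E, (hK.union hγ hD hdisj).isCrossSection hγ fun z => ?_, ?_⟩
  · obtain ⟨y, hy, t, rfl⟩ := hC₀s z
    by_cases hyE : y ∈ E
    · obtain ⟨x, hx, s, rfl⟩ := hEK hyE
      exact ⟨x, .inl hx, s + t, (hγ.2.1 x s t).symm⟩
    · exact ⟨y, .inr ⟨hy, hyE⟩, t, rfl⟩
  · rw [union_inter_distrib_right, hKC', union_eq_left]
    exact fun x hx => absurd (hAE ⟨hx.1.1, .inr hx.2⟩) hx.1.2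
end

section
/- There exist a shift of finite type (X, σ) and a homeomorphism h of the mapping torus 𝕊X of σ such that h ∈ Homeo₊ᵒʳᵇ(𝕊X) but h ∉ Homeo₊ⁱˢᵒ(𝕊X); that is, h maps each orbit of the suspension flow onto itself preserving the flow orientation, yet h is not isotopic to the identity. (Such an example exists with X a reducible SFT consisting of two fixed points and finitely many connecting orbits, with h acting as the shift on one connecting orbit and as the identity elsewhere.) -/
open Set Topology

/-- The mapping-torus identification on `X × ℝ`, where `X ⊆ A^ℤ`: `(x,t) ∼ (σᵏx, t - k)`.
The quotient `Quot (suspRel X)` is the mapping torus `𝕊X` of the shift on `X`. -/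
def suspRel {A : Type*} (X : Set (ℤ → A)) (p q : ↥X × ℝ) : Prop :=
  ∃ k : ℤ, (∀ m : ℤ, (q.1 : ℤ → A) m = (p.1 : ℤ → A) (m + k)) ∧ q.2 = p.2 - k

section MappingTorus

open scoped unitInterval

variable {A : Type*} {X : Set (ℤ → A)}

theorem suspRel_equivalence (X : Set (ℤ → A)) : Equivalence (suspRel X) where
  refl p := ⟨0, by simp, by simp⟩
  symm := by
    rintro p q ⟨k, hk, ht⟩
    refine ⟨-k, fun m => ?_, by push_cast; linarith⟩
    rw [hk, neg_add_cancel_right]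
  trans := by
    rintro p q r ⟨k, hk, ht⟩ ⟨l, hl, hs⟩
    refine ⟨l + k, fun m => ?_, by push_cast; linarith⟩
    rw [hl, hk, add_assoc]

theorem mk_suspRel_eq_iff {p q : X × ℝ} :
    Quot.mk (suspRel X) p = Quot.mk (suspRel X) q ↔ suspRel X p q :=
  Quot.eq.trans (suspRel_equivalence X).eqvGen_iff

/-- The suspension flow on the mapping torus of a shift space. -/
def suspFlow (X : Set (ℤ → A)) (y : Quot (suspRel X)) (s : ℝ) : Quot (suspRel X) :=
  Quot.map (fun p : X × ℝ => (p.1, p.2 + s))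
    (fun _ _ ⟨k, hk, ht⟩ => ⟨k, hk, by dsimp only; linarith⟩) y

theorem suspFlow_mk (x : X) (t s : ℝ) :
    suspFlow X (Quot.mk _ (x, t)) s = Quot.mk _ (x, t + s) :=
  rfl

theorem suspFlow_add (y : Quot (suspRel X)) (s t : ℝ) :
    suspFlow X (suspFlow X y s) t = suspFlow X y (s + t) := by
  obtain ⟨x, u⟩ := y
  simp only [suspFlow_mk, add_assoc]

/-- The action of `ℤ` on `X × ℝ` by deck transformations of the mapping torus. -/
abbrev deckAction (hX : ∀ x ∈ X, ∀ k : ℤ, (fun n => x (n + k)) ∈ X) : AddAction ℤ (X × ℝ) where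
  vadd k p := (⟨fun n => p.1.1 (n + k), hX _ p.1.2 k⟩, p.2 - k)
  zero_vadd p := Prod.ext (Subtype.ext (funext fun n => congrArg p.1.1 (add_zero n)))
    (by change p.2 - ((0 : ℤ) : ℝ) = p.2; simp)
  add_vadd k l p := Prod.ext
    (Subtype.ext (funext fun n => congrArg p.1.1 (by ring)))
    (by change p.2 - ((k + l : ℤ) : ℝ) = p.2 - l - k; push_cast; ring)

variable [TopologicalSpace A]

theorem isCoveringMap_mk_suspRel (hX : ∀ x ∈ X, ∀ k : ℤ, (fun n => x (n + k)) ∈ X) :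
    IsCoveringMap (Quot.mk (suspRel X)) := by
  let := deckAction hX
  have vadd_snd : ∀ (k : ℤ) (p : X × ℝ), (k +ᵥ p).2 = p.2 - k := fun _ _ => rfl
  have h : IsAddQuotientCoveringMap (Quot.mk (suspRel X)) ℤ :=
    { toIsQuotientMap := isQuotientMap_quot_mk
      continuous_const_vadd := fun k => by
        have hfst : Continuous fun p : X × ℝ => fun n => p.1.1 (n + k) :=
          continuous_pi fun n => (continuous_apply (n + k)).comp
            (continuous_subtype_val.comp continuous_fst)
        exact (hfst.subtype_mk fun p => hX _ p.1.2 k).prodMk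
          (continuous_snd.sub continuous_const)
      apply_eq_iff_mem_orbit := by
        intro p q
        rw [mk_suspRel_eq_iff]
        constructor
        · intro h
          obtain ⟨k, hk, ht⟩ := (suspRel_equivalence X).symm h
          exact ⟨k, Prod.ext (Subtype.ext (funext fun n => (hk n).symm)) ht.symm⟩
        · rintro ⟨k, rfl⟩
          exact (suspRel_equivalence X).symm ⟨k, fun _ => rfl, rfl⟩
      disjoint := by
        rintro ⟨x, t⟩
        refine ⟨Prod.snd ⁻¹' Metric.ball t (1 / 2),
          continuous_snd.continuousAt.preimage_mem_nhds
            (Metric.ball_mem_nhds _ one_half_pos), ?_⟩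
        rintro k ⟨_, ⟨p, hp, rfl⟩, hq⟩
        simp only [mem_preimage, vadd_snd, Metric.mem_ball, Real.dist_eq, abs_lt] at hp hq
        have h₁ : (k : ℝ) < 1 := by linarith [hp.2, hq.1]
        have h₂ : (-1 : ℝ) < k := by linarith [hp.1, hq.2]
        norm_cast at h₁ h₂
        lia }
  exact h.isCoveringMap

theorem isFlow_suspFlow (hX : ∀ x ∈ X, ∀ k : ℤ, (fun n => x (n + k)) ∈ X) :
    IsFlow (suspFlow X) := by
  refine ⟨?_, suspFlow_add, ?_, ?_⟩
  · have hq : IsOpenQuotientMap (Quot.mk (suspRel X)) :=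
      ⟨Quot.mk_surjective, continuous_quot_mk, (isCoveringMap_mk_suspRel hX).isOpenMap⟩
    rw [← (hq.prodMap IsOpenQuotientMap.id).continuous_comp_iff]
    change Continuous fun p : (X × ℝ) × ℝ => Quot.mk (suspRel X) (p.1.1, p.1.2 + p.2)
    exact continuous_quot_mk.comp (by fun_prop)
  · rintro ⟨x, t⟩
    exact congrArg (fun s => Quot.mk (suspRel X) (x, s)) (add_zero t)
  · rintro ⟨x, t⟩
    refine ⟨1 / 2, fun h => ?_⟩
    obtain ⟨k, -, hk⟩ := mk_suspRel_eq_iff.1 h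
    have h₁ : (2 : ℝ) * k = 1 := by dsimp only at hk; linarith
    norm_cast at h₁
    lia

/-- A homotopy of the mapping torus starting at the identity ends at a map which displaces every
point along its orbit, by an amount which is continuous on `X × ℝ`. -/
theorem exists_continuous_displacement [TotallyDisconnectedSpace A]
    (hX : ∀ x ∈ X, ∀ k : ℤ, (fun n => x (n + k)) ∈ X)
    {H : Quot (suspRel X) → ℝ → Quot (suspRel X)}
    (hH : ContinuousOn (fun p : Quot (suspRel X) × ℝ => H p.1 p.2) (univ ×ˢ Icc 0 1))
    (h₀ : ∀ y, H y 0 = y) :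
    ∃ f : X × ℝ → ℝ, Continuous f ∧
      ∀ x t, H (Quot.mk _ (x, t)) 1 = Quot.mk _ (x, f (x, t)) := by
  have cov := isCoveringMap_mk_suspRel hX
  let G : C(I × (X × ℝ), Quot (suspRel X)) :=
    ⟨fun p => H (Quot.mk _ p.2) p.1, hH.comp_continuous
      (f := fun p : I × (X × ℝ) => (Quot.mk (suspRel X) p.2, (p.1 : ℝ)))
      ((continuous_quot_mk.comp continuous_snd).prodMk (by fun_prop))
      fun p => ⟨mem_univ _, p.1.2⟩⟩
  have G₀ : ∀ p, G (0, p) = Quot.mk (suspRel X) (ContinuousMap.id (X × ℝ) p) := fun p => h₀ _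
  let L := cov.liftHomotopy G (.id _) G₀
  have fst_L : ∀ s p, (L (s, p)).1 = p.1 := fun s p => by
    have hc : Continuous fun s => (L (s, p)).1 := by fun_prop
    have h0 : L (0, p) = p := cov.liftHomotopy_zero G (.id _) G₀ p
    calc (L (s, p)).1 = (L (0, p)).1 :=
          (isPreconnected_range hc).subsingleton (mem_range_self s) (mem_range_self 0)
      _ = p.1 := by rw [h0]
  refine ⟨fun p => (L (1, p)).2, by fun_prop, fun x t => ?_⟩
  have h₁ : Quot.mk (suspRel X) (L (1, (x, t))) = H (Quot.mk _ (x, t)) 1 :=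
    congrFun (cov.liftHomotopy_lifts G (.id _) G₀) (1, (x, t))
  rw [← h₁]
  exact congrArg (Quot.mk _) (Prod.ext (fst_L _ _) rfl)

end MappingTorus

section ConnectingShift

/-- The shift of finite type formed by the three fixed points `0^∞`, `1^∞`, `2^∞` and the two
connecting orbits of `0^∞1^∞` and `0^∞2^∞`. -/
def connectingShift : Set (ℤ → Fin 3) :=
  {x | ∀ n, x n = 0 ∨ x n = x (n + 1)}

theorem translate_mem_connectingShift (x : ℤ → Fin 3) (hx : x ∈ connectingShift) (k : ℤ) :
    (fun n => x (n + k)) ∈ connectingShift := fun n => by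
  simpa only [add_right_comm] using hx (n + k)

theorem isSubshift_connectingShift : IsSubshift connectingShift := by
  refine ⟨⟨fun _ => 0, fun _ => .inl rfl⟩, ?_, ?_⟩
  · simp only [connectingShift, ofPred_forall]
    refine isClosed_iInter fun n => IsClosed.union ?_ ?_
    · exact isClosed_eq (continuous_apply n) continuous_const
    · exact isClosed_eq (continuous_apply n) (continuous_apply (n + 1))
  · refine Subset.antisymm ?_ fun x hx => ?_
    · rintro _ ⟨x, hx, rfl⟩
      exact translate_mem_connectingShift x hx 1
    · exact ⟨_, translate_mem_connectingShift x hx (-1), funext fun n => by simp [shiftMap]⟩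

theorem wordOccursAt_pair {A : Type*} (a b : A) (x : ℤ → A) (n : ℤ) :
    wordOccursAt [a, b] x n ↔ x n = a ∧ x (n + 1) = b := by
  constructor
  · intro h
    exact ⟨by simpa using h 0 (by simp), by simpa using h 1 (by simp)⟩
  · rintro ⟨ha, hb⟩ i hi
    simp only [List.length_cons, List.length_nil] at hi
    interval_cases i <;> simpa

theorem isSFT_connectingShift : IsSFT connectingShift := by
  refine ⟨(fun p : Fin 3 × Fin 3 => [p.1, p.2]) '' {p | ¬ (p.1 = 0 ∨ p.1 = p.2)},
    (toFinite _).image _, ?_⟩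
  ext x
  simp only [connectingShift, mem_ofPred_eq, forall_mem_image, wordOccursAt_pair, Prod.forall]
  constructor
  · rintro hx a b hab n ⟨rfl, rfl⟩
    exact hab (hx n)
  · intro h n
    by_contra hn
    exact h _ _ hn n ⟨rfl, rfl⟩

theorem eq_of_le_of_mem_connectingShift {x : ℤ → Fin 3} (hx : x ∈ connectingShift) {m n : ℤ}
    (hm : x m ≠ 0) (hmn : m ≤ n) : x n = x m := by
  induction n, hmn using Int.leInduction with
  | base => rfl
  | succ k _ ih => rw [← ih]; exact ((hx k).resolve_left (ih ▸ hm)).symm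

/-- The block code which shifts `0^∞1^∞` and fixes the orbit of `0^∞2^∞`. -/
def advance (x : ℤ → Fin 3) (n : ℤ) : Fin 3 :=
  if x n = 0 ∧ x (n + 1) = 1 then 1 else x n

/-- The inverse of `advance` on `connectingShift`. -/
def retreat (x : ℤ → Fin 3) (n : ℤ) : Fin 3 :=
  if x n = 1 ∧ x (n - 1) = 0 then 0 else x n

theorem advance_mem {x : ℤ → Fin 3} (hx : x ∈ connectingShift) :
    advance x ∈ connectingShift := fun n => by
  have h₀ := hx n
  have h₁ := hx (n + 1)
  simp only [advance]
  grind

theorem retreat_mem {x : ℤ → Fin 3} (hx : x ∈ connectingShift) :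
    retreat x ∈ connectingShift := fun n => by
  have h₀ := hx n
  have h₁ := hx (n - 1)
  simp only [retreat, add_sub_cancel_right, sub_add_cancel] at *
  grind

theorem retreat_advance {x : ℤ → Fin 3} (hx : x ∈ connectingShift) :
    retreat (advance x) = x := funext fun n => by
  have h₀ := hx n
  have h₁ := hx (n - 1)
  simp only [retreat, advance, sub_add_cancel] at *
  grind

theorem advance_retreat {x : ℤ → Fin 3} (hx : x ∈ connectingShift) :
    advance (retreat x) = x := funext fun n => by
  have h₀ := hx n
  have h₁ := hx (n - 1)
  simp only [retreat, advance, add_sub_cancel_right, sub_add_cancel] at *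
  grind

theorem continuous_comp_apply_apply {A : Type*} [TopologicalSpace A] [DiscreteTopology A]
    (m n : ℤ) (F : A → A → A) : Continuous fun x : ℤ → A => F (x m) (x n) :=
  (continuous_of_discreteTopology (f := fun p : A × A => F p.1 p.2)).comp
    (f := fun x : ℤ → A => (x m, x n)) ((continuous_apply m).prodMk (continuous_apply n))

theorem advance_eq_self_or_shift {x : ℤ → Fin 3} (hx : x ∈ connectingShift) :
    advance x = x ∨ advance x = fun n => x (n + 1) := by
  by_cases h : ∃ m, x m = 1
  · obtain ⟨m, hm⟩ := h
    refine .inr (funext fun n => ?_)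
    have h₂ : ∀ k, x k ≠ 2 := fun k hk => by
      have := eq_of_le_of_mem_connectingShift hx (by simp [hm]) (le_max_left m k)
      have := eq_of_le_of_mem_connectingShift hx (by simp [hk]) (le_max_right m k)
      simp_all
    have h₀ := hx n
    have h₃ := h₂ (n + 1)
    simp only [advance]
    grind
  · push Not at h
    exact .inl (funext fun n => by simp [advance, h])

/-- The homeomorphism of `connectingShift` given by `advance`. -/
def advanceHomeomorph : connectingShift ≃ₜ connectingShift where
  toFun x := ⟨advance x, advance_mem x.2⟩
  invFun x := ⟨retreat x, retreat_mem x.2⟩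
  left_inv x := Subtype.ext (retreat_advance x.2)
  right_inv x := Subtype.ext (advance_retreat x.2)
  continuous_toFun := ((continuous_pi fun n =>
    continuous_comp_apply_apply n (n + 1) fun a b => if a = 0 ∧ b = 1 then 1 else a).comp
      continuous_subtype_val).subtype_mk _
  continuous_invFun := ((continuous_pi fun n =>
    continuous_comp_apply_apply n (n - 1) fun a b => if a = 1 ∧ b = 0 then 0 else a).comp
      continuous_subtype_val).subtype_mk _

@[simp]
theorem coe_advanceHomeomorph (x : connectingShift) :
    (advanceHomeomorph x : ℤ → Fin 3) = advance x :=
  rfl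

@[simp]
theorem coe_advanceHomeomorph_symm (x : connectingShift) :
    (advanceHomeomorph.symm x : ℤ → Fin 3) = retreat x :=
  rfl

/-- The homeomorphism of the mapping torus of `connectingShift` induced by `advance`. -/
def advanceTorus : Quot (suspRel connectingShift) ≃ₜ Quot (suspRel connectingShift) where
  toFun := Quot.map (Prod.map advanceHomeomorph id) fun p q ⟨k, hk, ht⟩ =>
    ⟨k, fun m => by
      simp [advance, hk, add_right_comm], ht⟩
  invFun := Quot.map (Prod.map advanceHomeomorph.symm id) fun p q ⟨k, hk, ht⟩ =>
    ⟨k, fun m => by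
      simp [retreat, hk, add_sub_right_comm], ht⟩
  left_inv := by rintro ⟨x, t⟩; simp [Quot.map]
  right_inv := by rintro ⟨x, t⟩; simp [Quot.map]
  continuous_toFun := continuous_quot_lift _ <| continuous_quot_mk.comp
    (advanceHomeomorph.continuous.prodMap continuous_id)
  continuous_invFun := continuous_quot_lift _ <| continuous_quot_mk.comp
    (advanceHomeomorph.symm.continuous.prodMap continuous_id)

theorem advanceTorus_mk (x : connectingShift) (t : ℝ) :
    advanceTorus (Quot.mk _ (x, t)) = Quot.mk _ (advanceHomeomorph x, t) :=
  rfl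

theorem advanceTorus_suspFlow (y : Quot (suspRel connectingShift)) (s : ℝ) :
    advanceTorus (suspFlow _ y s) = suspFlow _ (advanceTorus y) s := by
  obtain ⟨x, t⟩ := y
  rfl

theorem exists_advanceTorus_eq_suspFlow (y : Quot (suspRel connectingShift)) :
    ∃ s, advanceTorus y = suspFlow _ y s := by
  obtain ⟨x, t⟩ := y
  rcases advance_eq_self_or_shift x.2 with h | h
  · exact ⟨0, mk_suspRel_eq_iff.2 ⟨0, fun m => by simp [h], by simp⟩⟩
  · exact ⟨1, mk_suspRel_eq_iff.2
      ⟨-1, fun m => by simp [h], by simp⟩⟩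

theorem flowOrbit_suspFlow {A : Type*} {X : Set (ℤ → A)} (y : Quot (suspRel X)) (s : ℝ) :
    flowOrbit (suspFlow X) (suspFlow X y s) = flowOrbit (suspFlow X) y := by
  ext z
  constructor
  · rintro ⟨t, rfl⟩
    exact ⟨s + t, (suspFlow_add y s t).symm⟩
  · rintro ⟨t, rfl⟩
    exact ⟨t - s, by rw [suspFlow_add, add_sub_cancel]⟩

theorem memHomeoPlusOrb_advanceTorus :
    MemHomeoPlusOrb (suspFlow connectingShift) advanceTorus := by
  have himage : ∀ y, advanceTorus '' flowOrbit (suspFlow _) y =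
      flowOrbit (suspFlow _) (advanceTorus y) := fun y => by
    simp only [flowOrbit, ← range_comp]
    exact congrArg range (funext (advanceTorus_suspFlow y))
  refine ⟨⟨⟨advanceTorus.continuous, himage, fun y => ?_⟩, advanceTorus.isHomeomorph⟩,
    fun y => ?_⟩
  · exact ⟨1, one_pos, id, continuousOn_id, strictMono_id.strictMonoOn _, rfl,
      fun t _ => advanceTorus_suspFlow y t⟩
  · obtain ⟨s, hs⟩ := exists_advanceTorus_eq_suspFlow y
    rw [himage, hs, flowOrbit_suspFlow]

/-- The point of `connectingShift` which is `0` before position `m` and `a` from there on. -/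
def stepPoint (a : Fin 3) (m : ℤ) : connectingShift :=
  ⟨fun n => if n < m then 0 else a, fun n => by dsimp only; grind⟩

theorem tendsto_stepPoint (a : Fin 3) :
    Filter.Tendsto (stepPoint a) Filter.atTop (𝓝 ⟨fun _ => 0, fun _ => .inl rfl⟩) := by
  rw [tendsto_subtype_rng, tendsto_pi_nhds]
  intro n
  refine tendsto_const_nhds.congr' ?_
  filter_upwards [Filter.eventually_gt_atTop n] with m hm
  simp [stepPoint, hm]

theorem advanceHomeomorph_stepPoint_one (m : ℤ) :
    advanceHomeomorph (stepPoint 1 m) = stepPoint 1 (m - 1) := by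
  ext n : 2
  simp only [coe_advanceHomeomorph, stepPoint, advance]
  grind

theorem advanceHomeomorph_stepPoint_two (m : ℤ) :
    advanceHomeomorph (stepPoint 2 m) = stepPoint 2 m := by
  ext n : 2
  simp only [coe_advanceHomeomorph, stepPoint, advance]
  grind

theorem eq_add_of_mk_stepPoint_eq {a : Fin 3} (ha : a ≠ 0) {m l : ℤ} {s t : ℝ}
    (h : Quot.mk (suspRel connectingShift) (stepPoint a l, t) =
      Quot.mk (suspRel connectingShift) (stepPoint a m, s)) : s = t + (m - l) := by
  obtain ⟨k, hk, ht⟩ := mk_suspRel_eq_iff.1 h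
  have h₁ := hk m
  have h₂ := hk (l - k)
  have h₃ := hk (m - 1)
  simp only [stepPoint] at h₁ h₂ h₃ ht
  have : k = l - m := by grind
  rw [ht, this]
  push_cast
  ring

theorem not_memHomeoPlusIso_advanceTorus :
    ¬ MemHomeoPlusIso (suspFlow connectingShift) advanceTorus := by
  rintro ⟨-, H, hH, -, h₀, h₁⟩
  obtain ⟨f, hf, hHf⟩ := exists_continuous_displacement translate_mem_connectingShift hH h₀
  have key : ∀ x, Quot.mk _ (advanceHomeomorph x, 0) = Quot.mk (suspRel _) (x, f (x, 0)) :=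
    fun x => by rw [← hHf, h₁, advanceTorus_mk]
  have lim : ∀ a, Filter.Tendsto (fun m => f (stepPoint a m, 0)) Filter.atTop
      (𝓝 (f (⟨fun _ => 0, fun _ => .inl rfl⟩, 0))) := fun a =>
    (hf.tendsto _).comp ((tendsto_stepPoint a).prodMk_nhds tendsto_const_nhds)
  have f_one : ∀ m, f (stepPoint 1 m, 0) = 1 := fun m => by
    have := key (stepPoint 1 m)
    rw [advanceHomeomorph_stepPoint_one] at this
    simpa using eq_add_of_mk_stepPoint_eq (by simp) this
  have f_two : ∀ m, f (stepPoint 2 m, 0) = 0 := fun m => by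
    have := key (stepPoint 2 m)
    rw [advanceHomeomorph_stepPoint_two] at this
    simpa using eq_add_of_mk_stepPoint_eq (by simp) this
  have l₁ := lim 1
  have l₂ := lim 2
  simp only [f_one, f_two] at l₁ l₂
  exact one_ne_zero ((tendsto_nhds_unique l₁ tendsto_const_nhds).symm.trans
    (tendsto_nhds_unique l₂ tendsto_const_nhds))

end ConnectingShift

/-- Examples 3.4/3.5 of the paper: there is a (reducible) shift of finite type `X` and a
self-homeomorphism `h` of the mapping torus `𝕊X` which maps each orbit of the suspension
flow onto itself preserving orientation, but which is not isotopic to the identity. -/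
theorem exists_sft_orbit_preserving_not_isotopic :
    ∃ (n : ℕ) (X : Set (ℤ → Fin n)), IsSubshift X ∧ IsSFT X ∧
      ∃ γ : Quot (suspRel X) → ℝ → Quot (suspRel X), IsFlow γ ∧
        (∀ (x : X) (t s : ℝ),
          γ (Quot.mk (suspRel X) (x, t)) s = Quot.mk (suspRel X) (x, t + s)) ∧
        ∃ h : Quot (suspRel X) → Quot (suspRel X),
          MemHomeoPlusOrb γ h ∧ ¬ MemHomeoPlusIso γ h := by
  exact ⟨3, connectingShift, isSubshift_connectingShift, isSFT_connectingShift,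
    suspFlow connectingShift, isFlow_suspFlow translate_mem_connectingShift, suspFlow_mk,
    advanceTorus, memHomeoPlusOrb_advanceTorus, not_memHomeoPlusIso_advanceTorus⟩
end

section
/- Let 𝕋² = (ℝ/ℤ) × (ℝ/ℤ), let γ be the flow γ(([x],[y]), t) = ([x], [y + t]), and let h : 𝕋² → 𝕋² be the homeomorphism h([x],[y]) = ([x], [x + y]). Then h maps each orbit of γ onto itself (preserving the flow orientation), but h is not homotopic to the identity map of 𝕋² (it induces a nontrivial automorphism of the fundamental group of 𝕋²); in particular h is not isotopic to the identity. -/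
open Set Topology

/-- The shear `(x, y) ↦ (x, x + y)` of a topological additive group, as a homeomorphism. -/
def shearHomeomorph (G : Type*) [AddCommGroup G] [TopologicalSpace G] [IsTopologicalAddGroup G] :
    G × G ≃ₜ G × G where
  toFun p := (p.1, p.1 + p.2)
  invFun p := (p.1, -p.1 + p.2)
  left_inv p := by simp
  right_inv p := by simp
  continuous_toFun := by fun_prop
  continuous_invFun := by fun_prop

/-- Orbits of the vertical flow on the torus are the vertical circles. -/
theorem flowOrbit_vertical (p : AddCircle (1:ℝ) × AddCircle (1:ℝ)) :
    flowOrbit (fun (p : AddCircle (1:ℝ) × AddCircle (1:ℝ)) (t : ℝ) =>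
      (p.1, p.2 + (t : AddCircle (1:ℝ)))) p = {q | q.1 = p.1} := by
  ext ⟨a, b⟩
  simp only [flowOrbit, mem_range, mem_ofPred_eq, Prod.mk.injEq, exists_and_left]
  refine ⟨fun h => h.1.symm, fun h => ⟨h.symm, ?_⟩⟩
  obtain ⟨t, ht⟩ := QuotientAddGroup.mk_surjective (b - p.2)
  exact ⟨t, by rw [show (t : AddCircle (1:ℝ)) = b - p.2 from ht]; abel⟩

/-- The shear maps each vertical circle onto itself. -/
theorem image_shear_vertical {G : Type*} [AddCommGroup G] (a : G) :
    (fun p : G × G => (p.1, p.1 + p.2)) '' {q | q.1 = a} = {q | q.1 = a} := by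
  ext ⟨b, c⟩
  constructor
  · rintro ⟨q, hq, h⟩
    exact (congrArg Prod.fst h).symm.trans hq
  · intro h
    exact ⟨(b, -b + c), h, by simp⟩

/-- The endpoint displacement of a lift is unchanged along a homotopy of loops in the circle. -/
theorem endpoint_displacement_eq (G : C(unitInterval × unitInterval, ℝ))
    (h : ∀ t, (G (t, 1) : AddCircle (1:ℝ)) = G (t, 0)) :
    G (0, 1) - G (0, 0) = G (1, 1) - G (1, 0) := by
  refine (AddCircle.isCoveringMap_coe (1:ℝ)).const_of_comp
    (g := fun t : unitInterval => G (t, 1) - G (t, 0)) (by fun_prop) (fun s t => ?_) 0 1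
  simp [h]

/-- A continuous family of loops in the circle cannot join the standard generator to a
constant loop. -/
theorem not_homotopic_generator_const (F : C(unitInterval × unitInterval, AddCircle (1:ℝ)))
    (hloop : ∀ t, F (t, 0) = F (t, 1))
    (h0 : ∀ s : unitInterval, F (0, s) = ((s : ℝ) : AddCircle (1:ℝ)))
    (h1 : ∀ s, F (1, s) = 0) : False := by
  have cov := AddCircle.isCoveringMap_coe (1:ℝ)
  let f : C(unitInterval, ℝ) := ⟨Subtype.val, continuous_subtype_val⟩
  let G := cov.liftHomotopy F f h0
  have hG (x) : (G x : AddCircle (1:ℝ)) = F x := congrFun (cov.liftHomotopy_lifts F f h0) x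
  have hG0 (s : unitInterval) : G (0, s) = s := cov.liftHomotopy_zero F f h0 s
  have hconst : G (1, 1) = G (1, 0) :=
    cov.const_of_comp (g := fun s : unitInterval => G (1, s)) (by fun_prop)
      (fun s t => by rw [hG, hG, h1, h1]) 1 0
  have key := endpoint_displacement_eq G fun t => by rw [hG, hG, hloop]
  rw [hG0, hG0, hconst] at key
  norm_num at key

/-- Example 3.2 of the paper: on the 2-torus `𝕋² = (ℝ/ℤ)²` with the vertical flow
`γ(([x],[y]),t) = ([x],[y+t])`, the Dehn twist `h([x],[y]) = ([x],[x+y])` maps each orbit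
onto itself preserving the flow orientation, but is not homotopic to the identity. -/
theorem dehn_twist_orbit_preserving_not_homotopic :
    MemHomeoPlusOrb
      (fun (p : AddCircle (1:ℝ) × AddCircle (1:ℝ)) (t : ℝ) => (p.1, p.2 + (t : AddCircle (1:ℝ))))
      (fun p => (p.1, p.1 + p.2)) ∧
    ¬ ∃ H : (AddCircle (1:ℝ) × AddCircle (1:ℝ)) × ℝ → AddCircle (1:ℝ) × AddCircle (1:ℝ),
        ContinuousOn H (Set.univ ×ˢ Set.Icc 0 1) ∧
        (∀ p : AddCircle (1:ℝ) × AddCircle (1:ℝ), H (p, 0) = (p.1, p.1 + p.2)) ∧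
        (∀ p : AddCircle (1:ℝ) × AddCircle (1:ℝ), H (p, 1) = p) := by
  have horb : ∀ p : AddCircle (1:ℝ) × AddCircle (1:ℝ), _ '' flowOrbit _ p = flowOrbit _ p :=
    fun p => by
      rw [flowOrbit_vertical]
      exact image_shear_vertical p.1
  refine ⟨⟨⟨⟨by fun_prop, fun p => ?_, fun p => ?_⟩,
    (shearHomeomorph (AddCircle (1:ℝ))).isHomeomorph⟩, horb⟩, ?_⟩
  · rw [horb, flowOrbit_vertical, flowOrbit_vertical]
  · exact ⟨1, one_pos, id, continuousOn_id, strictMonoOn_id, rfl, fun t _ => by simp [add_assoc]⟩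
  · rintro ⟨H, hH, h0, h1⟩
    let F : C(unitInterval × unitInterval, AddCircle (1:ℝ)) :=
      { toFun := fun x => (H ((((x.2 : ℝ) : AddCircle (1:ℝ)), 0), x.1)).2
        continuous_toFun := continuous_snd.comp <| hH.comp_continuous
          (by fun_prop) fun x => ⟨mem_univ _, x.1.2⟩ }
    refine not_homotopic_generator_const F (fun t => ?_) (fun s => ?_) fun s => ?_
    · simp [F, AddCircle.coe_period]
    · simp [F, h0]
    · simp [F, h1]
end
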